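/- For every γ ≥ 0, the set {A : L(A) > 0} is dense in C^γ(Σ, SL₂(ℝ)) with respect to the C^γ norm (for γ = 0 this means: dense in the space of continuous maps Σ → SL₂(ℝ) with the uniform metric). (Avila's density theorem.) -/

import Mathlib

open MeasureTheory

noncomputable section

abbrev Mat2 : Type := Matrix (Fin 2) (Fin 2) ℝ
abbrev SL2 : Type := Matrix.SpecialLinearGroup (Fin 2) ℝ
abbrev E2 : Type := EuclideanSpace ℝ (Fin 2)
abbrev Pone : Type := Projectivization ℝ E2

instance : TopologicalSpace SL2 :=
  inferInstanceAs (TopologicalSpace { A : Mat2 // A.det = 1 })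

/-- The operator norm of a 2×2 real matrix, acting on Euclidean ℝ². -/
def opNorm (M : Mat2) : ℝ := ‖Matrix.toEuclideanCLM (𝕜 := ℝ) M‖

/-- The continuous linear map on Euclidean ℝ² induced by a matrix in SL₂(ℝ). -/
def toEuc (g : SL2) : E2 →L[ℝ] E2 := Matrix.toEuclideanCLM (𝕜 := ℝ) (g : Mat2)

lemma toEuc_injective (g : SL2) : Function.Injective (toEuc g) := by
  intro x y hxy
  have key : ∀ z, toEuc g⁻¹ (toEuc g z) = z := by
    intro z
    have h1 : ((g⁻¹ : SL2) : Mat2) * (g : Mat2) = 1 := by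
      rw [← Matrix.SpecialLinearGroup.coe_mul, inv_mul_cancel,
        Matrix.SpecialLinearGroup.coe_one]
    calc toEuc g⁻¹ (toEuc g z)
        = (Matrix.toEuclideanCLM (𝕜 := ℝ) (((g⁻¹ : SL2) : Mat2) * (g : Mat2))) z := by
          rw [map_mul]; rfl
      _ = z := by rw [h1, map_one]; rfl
  have := congrArg (toEuc g⁻¹) hxy
  rwa [key, key] at this

/-- The projective action of SL₂(ℝ) on the real projective line ℙ¹. -/
def pact (g : SL2) : Pone → Pone :=
  Projectivization.map (toEuc g).toLinearMap (toEuc_injective g)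

instance : MeasurableSpace Pone :=
  inferInstanceAs (MeasurableSpace (Quotient (projectivizationSetoid ℝ E2)))

instance : TopologicalSpace Pone :=
  inferInstanceAs (TopologicalSpace (Quotient (projectivizationSetoid ℝ E2)))

/-- The space `Σ = {1,…,κ}^ℤ` of bilateral sequences in `κ` symbols. -/
abbrev Sig (κ : ℕ) : Type := ℤ → Fin κ

/-- The left shift map `σ((x_n)_n) = (x_{n+1})_n`. -/
def shift {κ : ℕ} (x : Sig κ) : Sig κ := fun n => x (n + 1)

/-- The cocycle iterates: `A^n(x) = A(σ^{n-1}x) ⋯ A(σ x) A(x)`. -/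
def cocycleN {κ : ℕ} (A : Sig κ → SL2) : ℕ → Sig κ → SL2
  | 0, _ => 1
  | n + 1, x => cocycleN A n (shift x) * A x

/-- `μ` is the Bernoulli measure `p^ℤ` on `Σ`: a probability measure giving each
cylinder its product measure. -/
def IsBernoulli {κ : ℕ} (p : Fin κ → ℝ) (μ : Measure (Sig κ)) : Prop :=
  IsProbabilityMeasure μ ∧
    ∀ (s : Finset ℤ) (a : ℤ → Fin κ),
      μ {x | ∀ n ∈ s, x n = a n} = ∏ n ∈ s, ENNReal.ofReal (p (a n))

/-- The Lyapunov exponent `L(A) = inf_{n ≥ 1} (1/n) ∫_Σ log‖A^n(x)‖ dμ(x)`. -/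
def lyap {κ : ℕ} (μ : Measure (Sig κ)) (A : Sig κ → SL2) : ℝ :=
  ⨅ n : {m : ℕ // 0 < m},
    (((n : ℕ) : ℝ))⁻¹ * ∫ x, Real.log (opNorm ((cocycleN A (n : ℕ) x : SL2) : Mat2)) ∂μ

/-- The first position (in absolute value) at which two sequences differ. -/
def firstDiff {κ : ℕ} (x y : Sig κ) : ℕ :=
  sInf {m : ℕ | x (m : ℤ) ≠ y (m : ℤ) ∨ x (-(m : ℤ)) ≠ y (-(m : ℤ))}

open Classical in
/-- The distance `d(x,y) = ζ^{-N(x,y)}` on `Σ`. -/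
def dSig {κ : ℕ} (ζ : ℝ) (x y : Sig κ) : ℝ :=
  if x = y then 0 else ζ ^ (-(firstDiff x y : ℤ))

/-- `A` is a cocycle with finite γ-Hölder seminorm w.r.t. the metric `dSig ζ`,
i.e. `A ∈ C^γ(Σ, SL₂(ℝ))`. -/
def HolderCocycle {κ : ℕ} (ζ γ : ℝ) (A : Sig κ → SL2) : Prop :=
  ∃ H : ℝ, ∀ x y : Sig κ, x ≠ y →
    opNorm ((A x : Mat2) - (A y : Mat2)) ≤ H * (dSig ζ x y) ^ γ

/-- `‖A − B‖_{C^γ} < ε`: there are a bound on the sup distance and a bound on the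
γ-Hölder seminorm of the difference, summing to less than `ε`. -/
def CgammaClose {κ : ℕ} (ζ γ : ℝ) (A B : Sig κ → SL2) (ε : ℝ) : Prop :=
  ∃ C₁ C₂ : ℝ, C₁ + C₂ < ε ∧
    (∀ x, opNorm ((A x : Mat2) - (B x : Mat2)) ≤ C₁) ∧
    (∀ x y : Sig κ, x ≠ y →
      opNorm (((A x : Mat2) - (B x : Mat2)) - ((A y : Mat2) - (B y : Mat2)))
        ≤ C₂ * (dSig ζ x y) ^ γ)

/-- Parametric integrals of bounded holomorphic functions are holomorphic. -/
lemma diffOn_integral {X : Type*} [MeasurableSpace X] (μ : Measure X) [IsFiniteMeasure μ]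
    (U : Set ℂ) (hU : IsOpen U) (h : ℂ → X → ℂ) (M : ℝ)
    (hd : ∀ᵐ x ∂μ, DifferentiableOn ℂ (fun z => h z x) U ∧ ∀ z ∈ U, ‖h z x‖ ≤ M)
    (hm : ∀ z ∈ U, AEStronglyMeasurable (h z) μ) :
    DifferentiableOn ℂ (fun z => ∫ x, h z x ∂μ) U := by
  intro z₀ hz₀
  obtain ⟨r, hr, hball⟩ := Metric.isOpen_iff.1 hU z₀ hz₀
  have hr2 : 0 < r / 2 := by positivity
  have hsub : Metric.ball z₀ (r/2) ⊆ U :=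
    (Metric.ball_subset_ball (by linarith)).trans hball
  have key := hasDerivAt_integral_of_dominated_loc_of_deriv_le (μ := μ) (𝕜 := ℂ)
    (F := h) (F' := fun z x => deriv (fun w => h w x) z) (x₀ := z₀) (s := Metric.ball z₀ (r/2))
    (bound := fun _ => M / (r/4)) (Metric.ball_mem_nhds _ hr2)
    (Filter.eventually_of_mem (hU.mem_nhds hz₀) hm)
    (Integrable.of_bound (hm z₀ hz₀) M (by
      filter_upwards [hd] with x hx using hx.2 z₀ hz₀))
    (by
      -- measurability of the derivative
      have hseq : ∀ n : ℕ, z₀ + ((r/2 * (1/((n:ℝ)+2)) : ℝ) : ℂ) ∈ U := by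
        intro n
        apply hsub
        rw [Metric.mem_ball, dist_eq_norm, add_sub_cancel_left, Complex.norm_real, Real.norm_eq_abs,
          abs_of_pos (by positivity)]
        have : 1/((n:ℝ)+2) < 1 := by
          rw [div_lt_one (by positivity)]; have : (0:ℝ) ≤ n := by positivity
          linarith
        nlinarith
      refine aestronglyMeasurable_of_tendsto_ae (Filter.atTop : Filter ℕ)
        (f := fun n x => (((r/2 * (1/((n:ℝ)+2)) : ℝ) : ℂ))⁻¹ •
          (h (z₀ + ((r/2 * (1/((n:ℝ)+2)) : ℝ) : ℂ)) x - h z₀ x)) ?_ ?_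
      · intro n
        exact ((hm _ (hseq n)).sub (hm _ hz₀)).const_smul (((r/2 * (1/((n:ℝ)+2)) : ℝ) : ℂ))⁻¹
      · filter_upwards [hd] with x hx
        have hda : HasDerivAt (fun w => h w x) (deriv (fun w => h w x) z₀) z₀ :=
          (hx.1.differentiableAt (hU.mem_nhds hz₀)).hasDerivAt
        have := hda.tendsto_slope_zero
        refine this.comp ?_
        rw [tendsto_nhdsWithin_iff]
        constructor
        · have h0 : Filter.Tendsto (fun n : ℕ => r/2 * (1/((n:ℝ)+2))) Filter.atTop (nhds (r/2 * 0)) := by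
            apply Filter.Tendsto.const_mul
            have := (tendsto_one_div_add_atTop_nhds_zero_nat (𝕜 := ℝ)).comp (Filter.tendsto_add_atTop_nat 1)
            refine this.congr ?_
            intro n; simp only [Function.comp]; push_cast; ring_nf
          rw [mul_zero] at h0
          have := (Complex.continuous_ofReal.tendsto 0).comp h0
          rw [Complex.ofReal_zero] at this
          exact this
        · filter_upwards with n
          have : (0:ℝ) < r/2 * (1/((n:ℝ)+2)) := by positivity
          simp only [Set.mem_compl_iff, Set.mem_singleton_iff]
          exact_mod_cast this.ne')
    (by
      filter_upwards [hd] with x hx z hz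
      have hcb : Metric.closedBall z (r/4) ⊆ U := by
        intro w hw
        apply hball
        rw [Metric.mem_closedBall] at hw
        rw [Metric.mem_ball] at hz ⊢
        have := dist_triangle w z z₀
        linarith
      apply Complex.norm_deriv_le_of_forall_mem_sphere_norm_le (by positivity)
      · apply DifferentiableOn.diffContOnCl
        apply hx.1.mono
        exact Metric.closure_ball_subset_closedBall.trans hcb
      · intro w hw
        exact hx.2 w (hcb (Metric.sphere_subset_closedBall hw)))
    (integrable_const _)
    (by
      filter_upwards [hd] with x hx z hz
      exact (hx.1.differentiableAt (hU.mem_nhds (hsub hz))).hasDerivAt)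
  exact key.2.differentiableAt.differentiableWithinAt

/-- The domain of parameters. -/
def Dom : Set (ℂ × ℂ) :=
  {p | 0 ≤ p.1.im ∧ |p.2.im| ≤ p.1.im / 8 ∧ ‖p.1‖ ≤ 1/16 ∧ ‖p.2‖ ≤ 1/16}

lemma isCompact_Dom : IsCompact Dom := by
  apply Metric.isCompact_of_isClosed_isBounded
  · have e : Dom = {p : ℂ × ℂ | 0 ≤ p.1.im} ∩ ({p | |p.2.im| ≤ p.1.im / 8} ∩
        ({p | ‖p.1‖ ≤ 1/16} ∩ {p | ‖p.2‖ ≤ 1/16})) := rfl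
    have c1 : Continuous fun p : ℂ × ℂ => p.1.im := Complex.continuous_im.comp continuous_fst
    have c2 : Continuous fun p : ℂ × ℂ => p.2.im := Complex.continuous_im.comp continuous_snd
    rw [e]
    exact (isClosed_le continuous_const c1).inter ((isClosed_le c2.abs (c1.div_const 8)).inter
      ((isClosed_le continuous_fst.norm continuous_const).inter
        (isClosed_le continuous_snd.norm continuous_const)))
  · rw [Metric.isBounded_iff_subset_closedBall (0 : ℂ × ℂ)]
    refine ⟨1/16, ?_⟩
    rintro p ⟨_, _, h3, h4⟩
    rw [mem_closedBall_zero_iff, Prod.norm_def]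
    exact max_le h3 h4

/-- amplitude curve -/
def qf (η : ℝ) (z : ℂ) : ℂ := (η:ℂ)^2 - z^2

lemma qf_eq (η x y : ℝ) : qf η (x + y * Complex.I) = ((η^2 - x^2 + y^2 : ℝ) : ℂ) + ((-2*x*y : ℝ):ℂ) * Complex.I := by
  unfold qf
  push_cast
  linear_combination (-(y:ℂ)^2) * Complex.I_sq

lemma norm_z_le (η x y : ℝ) (hη2 : η ≤ 1/100) (hx : |x| ≤ η) (hy : 0 ≤ y) (hy' : y ≤ η) :
    ‖(x + y * Complex.I : ℂ)‖ ≤ 1/16 := by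
  calc ‖(x + y * Complex.I : ℂ)‖ ≤ ‖(x:ℂ)‖ + ‖(y * Complex.I : ℂ)‖ := norm_add_le _ _
    _ = |x| + |y| := by simp
    _ ≤ 1/16 := by rw [abs_of_nonneg hy]; linarith

/-- real `lam`, rectangle. -/
lemma mem_Dom_real (η x y lam : ℝ) (hη : 0 < η) (hη2 : η ≤ 1/100) (hx : |x| ≤ η) (hy : 0 ≤ y) (hy' : y ≤ η)
    (hl : |lam| ≤ 2) : ((x + y * Complex.I : ℂ), (lam:ℂ) * qf η (x + y * Complex.I)) ∈ Dom := by
  have hx2 : x^2 ≤ η^2 := by rw [← sq_abs]; gcongr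
  refine ⟨by simpa using hy, ?_, norm_z_le η x y hη2 hx hy hy', ?_⟩
  · rw [qf_eq]
    simp only [Complex.add_im, Complex.mul_im, Complex.ofReal_re, Complex.ofReal_im, Complex.I_re, Complex.I_im,
      Complex.add_re, Complex.mul_re]
    simp only [mul_zero, mul_one, add_zero, zero_add, zero_mul, sub_zero, abs_mul, abs_neg]
    rw [abs_of_nonneg hy, abs_two]
    have := abs_nonneg x
    have := abs_nonneg lam
    have h1 : |lam| * |x| ≤ 2 * (1/100) := by apply mul_le_mul <;> linarith
    nlinarith
  · rw [qf_eq, norm_mul, Complex.norm_real, Real.norm_eq_abs]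
    have h1 : ‖((η^2 - x^2 + y^2 : ℝ) : ℂ) + ((-2*x*y : ℝ):ℂ) * Complex.I‖ ≤ 1/32 := by
      refine (norm_add_le _ _).trans ?_
      rw [norm_mul, Complex.norm_real, Complex.norm_real, Complex.norm_I, mul_one, Real.norm_eq_abs, Real.norm_eq_abs,
        abs_mul, abs_mul, abs_neg, abs_two, abs_of_nonneg hy, abs_of_nonneg (by nlinarith)]
      have : |x| * y ≤ η * η := by gcongr
      nlinarith [sq_nonneg x]
    have := norm_nonneg (((η^2 - x^2 + y^2 : ℝ) : ℂ) + ((-2*x*y : ℝ):ℂ) * Complex.I)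
    have := abs_nonneg lam
    nlinarith

/-- contour, complex `lam`. -/
lemma mem_Dom_contour (η x y : ℝ) (lam : ℂ) (hη : 0 < η) (hη2 : η ≤ 1/100) (hx : |x| ≤ η) (hy : 0 ≤ y) (hy' : y ≤ η)
    (hc : |x| = η ∨ y = η)
    (hl : ‖lam‖ ≤ 2) : ((x + y * Complex.I : ℂ), lam * qf η (x + y * Complex.I)) ∈ Dom := by
  have hx2 : x^2 ≤ η^2 := by rw [← sq_abs]; gcongr
  have h1 : ‖qf η (x + y * Complex.I)‖ ≤ 4 * η * y := by
    rw [qf_eq]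
    refine (norm_add_le _ _).trans ?_
    rw [norm_mul, Complex.norm_real, Complex.norm_real, Complex.norm_I, mul_one, Real.norm_eq_abs, Real.norm_eq_abs,
        abs_mul, abs_mul, abs_neg, abs_two, abs_of_nonneg hy, abs_of_nonneg (by nlinarith)]
    have : |x| * y ≤ η * y := by gcongr
    rcases hc with h | h
    · have : x^2 = η^2 := by rw [← sq_abs, h]
      nlinarith
    · subst h
      nlinarith [sq_nonneg x]
  have h2 : ‖lam * qf η (x + y * Complex.I)‖ ≤ 8 * η * y := by
    rw [norm_mul]
    have := norm_nonneg (qf η (x + y * Complex.I))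
    nlinarith
  refine ⟨by simpa using hy, ?_, norm_z_le η x y hη2 hx hy hy', ?_⟩
  · refine (Complex.abs_im_le_norm _).trans (h2.trans ?_)
    simp only [Complex.add_im, Complex.mul_im, Complex.ofReal_re, Complex.ofReal_im, Complex.I_re, Complex.I_im]
    nlinarith
  · nlinarith

/-- integral over the upper three sides of the rectangle, from `-η` to `η`. -/
def contour (η : ℝ) (g : ℂ × ℂ → ℂ) (lam : ℂ) : ℂ :=
  (∫ x in (-η)..η, g ((x + η * Complex.I : ℂ), lam * qf η (x + η * Complex.I)))
  - Complex.I * (∫ y in (0:ℝ)..η, g ((η + y * Complex.I : ℂ), lam * qf η (η + y * Complex.I)))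
  + Complex.I * (∫ y in (0:ℝ)..η, g (((-η : ℝ) + y * Complex.I : ℂ), lam * qf η ((-η : ℝ) + y * Complex.I)))

lemma contour_eq (η : ℝ) (hη : 0 < η) (hη2 : η ≤ 1/100) (g : ℂ × ℂ → ℂ) (hg : ContinuousOn g Dom)
    (lam : ℝ) (hl : |lam| ≤ 2)
    (hd : DifferentiableOn ℂ (fun z => g (z, lam * qf η z)) (Set.Ioo (-η) η ×ℂ Set.Ioo 0 η)) :
    ∫ t in (-η)..η, g ((t:ℂ), lam * qf η t) = contour η g lam := by
  have key := Complex.integral_boundary_rect_eq_zero_of_continuousOn_of_differentiableOn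
    (fun z => g (z, lam * qf η z)) ((-η : ℝ) : ℂ) (η + η * Complex.I) ?_ ?_
  · simp only [Complex.ofReal_re, Complex.ofReal_im, Complex.add_re, Complex.add_im, Complex.mul_re, Complex.mul_im,
      Complex.I_re, Complex.I_im, mul_zero, mul_one, zero_mul, sub_zero, add_zero, zero_add, smul_eq_mul,
      Complex.ofReal_zero] at key
    unfold contour
    linear_combination key
  · simp only [Complex.ofReal_re, Complex.ofReal_im, Complex.add_re, Complex.add_im, Complex.mul_re, Complex.mul_im,
      Complex.I_re, Complex.I_im, mul_zero, mul_one, zero_mul, sub_zero, add_zero, zero_add]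
    refine hg.comp (Continuous.continuousOn (by unfold qf; fun_prop)) ?_
    intro z hz
    rw [Complex.mem_reProdIm, Set.uIcc_of_le (by linarith), Set.uIcc_of_le hη.le] at hz
    have := mem_Dom_real η z.re z.im lam hη hη2 (abs_le.2 hz.1) hz.2.1 hz.2.2 hl
    rwa [Complex.re_add_im] at this
  · simp only [Complex.ofReal_re, Complex.ofReal_im, Complex.add_re, Complex.add_im, Complex.mul_re, Complex.mul_im,
      Complex.I_re, Complex.I_im, mul_zero, mul_one, zero_mul, sub_zero, add_zero, zero_add]
    rwa [min_eq_left (by linarith), max_eq_right (by linarith), min_eq_left hη.le, max_eq_right hη.le]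

lemma contour_diff (η : ℝ) (hη : 0 < η) (hη2 : η ≤ 1/100) (g : ℂ × ℂ → ℂ) (hg : ContinuousOn g Dom)
    (hd : ∀ z : ℂ, (∀ lam : ℂ, ‖lam‖ ≤ 2 → (z, lam * qf η z) ∈ Dom) →
      DifferentiableOn ℂ (fun lam => g (z, lam * qf η z)) (Metric.ball 0 2)) :
    DifferentiableOn ℂ (contour η g) (Metric.ball 0 2) := by
  obtain ⟨M, hM⟩ := isCompact_Dom.exists_bound_of_continuousOn hg
  -- general side
  have side : ∀ (a b : ℝ) (c : ℝ → ℂ), a ≤ b → Continuous c →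
      (∀ t ∈ Set.Icc a b, ∀ lam : ℂ, ‖lam‖ ≤ 2 → (c t, lam * qf η (c t)) ∈ Dom) →
      DifferentiableOn ℂ (fun lam : ℂ => ∫ t in a..b, g (c t, lam * qf η (c t))) (Metric.ball 0 2) := by
    intro a b c hab hc hD
    simp only [intervalIntegral.integral_of_le hab]
    apply diffOn_integral _ _ Metric.isOpen_ball _ M
    · rw [ae_restrict_iff' measurableSet_Ioc]
      refine Filter.Eventually.of_forall (fun t ht => ⟨hd (c t) (hD t (Set.Ioc_subset_Icc_self ht)), ?_⟩)
      intro lam hl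
      exact hM _ (hD t (Set.Ioc_subset_Icc_self ht) lam (by simpa using (mem_ball_zero_iff.1 hl).le))
    · intro lam hl
      have : ContinuousOn (fun t => g (c t, lam * qf η (c t))) (Set.Ioc a b) := by
        refine hg.comp (Continuous.continuousOn (by unfold qf; fun_prop)) ?_
        intro t ht
        exact hD t (Set.Ioc_subset_Icc_self ht) lam (by simpa using (mem_ball_zero_iff.1 hl).le)
      exact this.aestronglyMeasurable measurableSet_Ioc
  unfold contour
  refine DifferentiableOn.add (DifferentiableOn.sub ?_ (DifferentiableOn.const_mul ?_ _)) (DifferentiableOn.const_mul ?_ _)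
  · apply side (-η) η (fun x => x + η * Complex.I) (by linarith) (by fun_prop)
    intro t ht lam hl
    exact mem_Dom_contour η t η lam hη hη2 (abs_le.2 ht) hη.le le_rfl (Or.inr rfl) hl
  · apply side 0 η (fun y => η + y * Complex.I) (by linarith) (by fun_prop)
    intro t ht lam hl
    exact mem_Dom_contour η η t lam hη hη2 (abs_of_pos hη).le ht.1 ht.2 (Or.inl (abs_of_pos hη)) hl
  · apply side 0 η (fun y => (-η : ℝ) + y * Complex.I) (by linarith) (by fun_prop)
    intro t ht lam hl
    exact mem_Dom_contour η (-η) t lam hη hη2 (by rw [abs_neg, abs_of_pos hη]) ht.1 ht.2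
      (Or.inl (by rw [abs_neg, abs_of_pos hη])) hl

/-- the bound for the logarithm -/
def bb (y : ℝ) : ℝ := 2 * Real.log 2 - Real.log y + Real.pi

/-- the universal constant -/
def CC (η : ℝ) : ℝ := bb η * (2 * η) + 2 * ∫ y in (0:ℝ)..η, bb y

lemma contour_bound (η : ℝ) (hη : 0 < η) (hη2 : η ≤ 1/100) (g : ℂ × ℂ → ℂ)
    (hb : ∀ p ∈ Dom, 0 < p.1.im → ‖g p‖ ≤ bb p.1.im) (lam : ℂ) (hl : ‖lam‖ ≤ 2) :
    ‖contour η g lam‖ ≤ CC η := by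
  have hbi : IntervalIntegrable bb volume 0 η := by
    unfold bb
    exact (intervalIntegrable_const.sub intervalIntegral.intervalIntegrable_log').add intervalIntegrable_const
  have h1 : ‖∫ x in (-η)..η, g ((x + η * Complex.I : ℂ), lam * qf η (x + η * Complex.I))‖ ≤ bb η * (2 * η) := by
    have := intervalIntegral.norm_integral_le_of_norm_le_const (a := -η) (b := η) (C := bb η)
      (f := fun x : ℝ => g ((x + η * Complex.I : ℂ), lam * qf η (x + η * Complex.I))) ?_
    · rwa [show η - -η = 2 * η by ring, abs_of_pos (by linarith)] at this
    · intro x hx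
      rw [Set.uIoc_of_le (by linarith)] at hx
      have := hb _ (mem_Dom_contour η x η lam hη hη2 (abs_le.2 ⟨hx.1.le, hx.2⟩) hη.le le_rfl (Or.inr rfl) hl)
        (by simpa using hη)
      simpa using this
  have side : ∀ c : ℝ, |c| = η → ‖∫ y in (0:ℝ)..η, g ((c + y * Complex.I : ℂ), lam * qf η (c + y * Complex.I))‖
      ≤ ∫ y in (0:ℝ)..η, bb y := by
    intro c hc
    apply intervalIntegral.norm_integral_le_of_norm_le hη.le _ hbi
    refine Filter.Eventually.of_forall (fun y hy => ?_)
    have := hb _ (mem_Dom_contour η c y lam hη hη2 hc.le hy.1.le hy.2 (Or.inl hc) hl) (by simpa using hy.1)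
    simpa using this
  unfold contour CC
  have h2 := side η (abs_of_pos hη)
  have h3 := side (-η) (by rw [abs_neg, abs_of_pos hη])
  refine (norm_add_le _ _).trans ?_
  refine (add_le_add_left (norm_sub_le _ _) _).trans ?_
  rw [norm_mul, norm_mul, Complex.norm_I, one_mul, one_mul]
  linarith

/-- Averaged holomorphic data. -/
structure GoodG {X : Type*} [TopologicalSpace X] (G : ℂ × ℂ → X → ℂ) : Prop where
  cont : ContinuousOn (Function.uncurry G) (Dom ×ˢ Set.univ)
  diff : ∀ x, ∀ p ∈ Dom, DifferentiableAt ℂ (fun p => G p x) p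

section
variable {X : Type*} [TopologicalSpace X] [CompactSpace X] [MeasurableSpace X] [OpensMeasurableSpace X]
  [SecondCountableTopology X] (μ : Measure X) [IsProbabilityMeasure μ]

lemma GoodG.continuousOn {G : ℂ × ℂ → X → ℂ} (h : GoodG G) : ContinuousOn (fun p => ∫ x, G p x ∂μ) Dom :=
  continuousOn_integral_of_compact_support isCompact_univ h.cont (by simp)

lemma GoodG.cont_x {G : ℂ × ℂ → X → ℂ} (h : GoodG G) {p : ℂ × ℂ} (hp : p ∈ Dom) : Continuous (G p) := by
  have : ContinuousOn (fun x => Function.uncurry G (p, x)) Set.univ := by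
    refine h.cont.comp (by fun_prop) ?_
    intro x _
    exact ⟨hp, trivial⟩
  exact continuousOn_univ.1 this

lemma GoodG.bdd {G : ℂ × ℂ → X → ℂ} (h : GoodG G) : ∃ M, ∀ p ∈ Dom, ∀ x, ‖G p x‖ ≤ M := by
  obtain ⟨M, hM⟩ := (isCompact_Dom.prod isCompact_univ).exists_bound_of_continuousOn h.cont
  exact ⟨M, fun p hp x => hM (p, x) ⟨hp, trivial⟩⟩

lemma GoodG.diffOn {G : ℂ × ℂ → X → ℂ} (h : GoodG G) (U : Set ℂ) (hU : IsOpen U) (c : ℂ → ℂ × ℂ)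
    (hc : Differentiable ℂ c) (hcU : ∀ z ∈ U, c z ∈ Dom) :
    DifferentiableOn ℂ (fun z => ∫ x, G (c z) x ∂μ) U := by
  obtain ⟨M, hM⟩ := h.bdd
  apply diffOn_integral μ U hU (fun z x => G (c z) x) M
  · refine Filter.Eventually.of_forall (fun x => ⟨?_, fun z hz => hM _ (hcU z hz) x⟩)
    intro z hz
    have := (h.diff x (c z) (hcU z hz)).comp z (hc z)
    exact this.differentiableWithinAt
  · intro z hz
    exact (h.cont_x (hcU z hz)).aestronglyMeasurable

lemma GoodG.contour_diff {G : ℂ × ℂ → X → ℂ} (h : GoodG G) (η : ℝ) (hη : 0 < η) (hη2 : η ≤ 1/100) :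
    DifferentiableOn ℂ (contour η (fun p => ∫ x, G p x ∂μ)) (Metric.ball 0 2) := by
  apply _root_.contour_diff η hη hη2 _ (h.continuousOn μ)
  intro z hz
  apply h.diffOn μ _ Metric.isOpen_ball (fun lam => (z, lam * qf η z)) (by fun_prop)
  intro lam hl
  exact hz lam (by simpa using (mem_ball_zero_iff.1 hl).le)

lemma GoodG.contour_eq {G : ℂ × ℂ → X → ℂ} (h : GoodG G) (η : ℝ) (hη : 0 < η) (hη2 : η ≤ 1/100)
    (lam : ℝ) (hl : |lam| ≤ 2) :
    ∫ t in (-η)..η, ∫ x, G ((t:ℂ), lam * qf η t) x ∂μ = contour η (fun p => ∫ x, G p x ∂μ) lam := by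
  apply _root_.contour_eq η hη hη2 _ (h.continuousOn μ) lam hl
  apply h.diffOn μ _ (isOpen_Ioo.reProdIm isOpen_Ioo) (fun z => (z, lam * qf η z)) (by unfold qf; fun_prop)
  intro z hz
  rw [Complex.mem_reProdIm] at hz
  have := mem_Dom_real η z.re z.im lam hη hη2 (abs_le.2 ⟨hz.1.1.le, hz.1.2.le⟩) hz.2.1.le hz.2.2.le hl
  rwa [Complex.re_add_im] at this

lemma GoodG.contour_bound {G : ℂ × ℂ → X → ℂ} (η : ℝ) (hη : 0 < η) (hη2 : η ≤ 1/100)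
    (hb : ∀ p ∈ Dom, 0 < p.1.im → ∀ x, ‖G p x‖ ≤ bb p.1.im) (lam : ℂ) (hl : ‖lam‖ ≤ 2) :
    ‖contour η (fun p => ∫ x, G p x ∂μ) lam‖ ≤ CC η := by
  apply _root_.contour_bound η hη hη2 _ _ lam hl
  intro p hp hp0
  have := norm_integral_le_of_norm_le_const (μ := μ) (f := G p) (Filter.Eventually.of_forall (hb p hp hp0))
  simpa using this
end

abbrev CMat : Type := Matrix (Fin 2) (Fin 2) ℂ

/-- `M` is invertible and maps the closed unit disc cone into the cone of aperture `k`. -/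
def Cone (k : ℝ) (M : CMat) : Prop :=
  M.det ≠ 0 ∧ ∀ u v : ℂ, ‖v‖ ≤ ‖u‖ → ‖M 1 0 * u + M 1 1 * v‖ ≤ k * ‖M 0 0 * u + M 0 1 * v‖

lemma Cone.mono {k l : ℝ} (hkl : k ≤ l) {M : CMat} (h : Cone k M) : Cone l M :=
  ⟨h.1, fun u v huv => (h.2 u v huv).trans (by gcongr)⟩

lemma Cone.mul {k : ℝ} {M N : CMat} (hM : Cone k M) (hN : Cone 1 N) : Cone k (M * N) := by
  refine ⟨by rw [Matrix.det_mul]; exact mul_ne_zero hM.1 hN.1, fun u v huv => ?_⟩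
  have := hM.2 (N 0 0 * u + N 0 1 * v) (N 1 0 * u + N 1 1 * v) (by simpa using hN.2 u v huv)
  simp only [Matrix.mul_apply, Fin.sum_univ_two]
  convert this using 2
  · ring
  · congr 1; ring

lemma Cone.one : Cone 1 (1 : CMat) := by
  refine ⟨by simp, fun u v huv => by simpa using huv⟩

lemma Cone.ne_zero {k : ℝ} {M : CMat} (hM : Cone k M) : M 0 0 ≠ 0 := by
  intro h
  have h1 := hM.2 1 0 (by simp)
  simp [h] at h1
  apply hM.1
  rw [Matrix.det_fin_two, h, h1]; simp

lemma Cone.norm10 {k : ℝ} {M : CMat} (hM : Cone k M) : ‖M 1 0 / M 0 0‖ ≤ k := by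
  have h1 := hM.2 1 0 (by simp)
  simp only [mul_one, mul_zero, add_zero] at h1
  rw [norm_div, div_le_iff₀ (norm_pos_iff.2 hM.ne_zero)]
  exact h1

lemma Cone.norm01 {M : CMat} (hM : Cone 1 M) : ‖M 0 1 / M 0 0‖ ≤ 1 := by
  rw [norm_div, div_le_one (norm_pos_iff.2 hM.ne_zero)]
  by_contra! h
  have h01 : M 0 1 ≠ 0 := by
    intro h0; rw [h0, norm_zero] at h; linarith [norm_nonneg (M 0 0)]
  have h1 := hM.2 (M 0 1) (-M 0 0) (by rw [norm_neg]; exact h.le)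
  rw [show M 0 0 * M 0 1 + M 0 1 * -M 0 0 = 0 by ring, norm_zero, mul_zero] at h1
  have h2 := norm_le_zero_iff.1 h1
  apply hM.1
  rw [Matrix.det_fin_two]
  linear_combination -h2

/-- the ratio of the top-left entries. -/
lemma ratio_form {k : ℝ} (hk : k ≤ 1) {M N : CMat} (hM : Cone 1 M) (hN : Cone k N) :
    ∃ w : ℂ, ‖w‖ ≤ k ∧ w ≠ -1 ∧ (M * N) 0 0 / (M 0 0 * N 0 0) = 1 + w := by
  have hM0 := hM.ne_zero
  have hN0 := hN.ne_zero
  have hMN := (hM.mul (hN.mono hk)).ne_zero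
  have heq : (M * N) 0 0 / (M 0 0 * N 0 0) = 1 + (M 0 1 / M 0 0) * (N 1 0 / N 0 0) := by
    simp only [Matrix.mul_apply, Fin.sum_univ_two]
    field_simp
  refine ⟨(M 0 1 / M 0 0) * (N 1 0 / N 0 0), ?_, ?_, heq⟩
  · rw [norm_mul]
    have := hM.norm01
    have := hN.norm10
    have := norm_nonneg (N 1 0 / N 0 0)
    have := norm_nonneg (M 0 1 / M 0 0)
    nlinarith
  · intro h
    rw [h, add_neg_cancel, div_eq_zero_iff] at heq
    rcases heq with h | h
    · exact hMN h
    · exact mul_ne_zero hM0 hN0 h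

lemma slit_of_form {w : ℂ} (hw : ‖w‖ ≤ 1) (hw1 : w ≠ -1) : 1 + w ∈ Complex.slitPlane := by
  rw [Complex.mem_slitPlane_iff]
  have h1 : |w.re| ≤ 1 := (Complex.abs_re_le_norm w).trans hw
  have h2 := (abs_le.1 h1).1
  rcases lt_or_eq_of_le h2 with h | h
  · left; simp; linarith
  · right
    intro h3
    apply hw1
    apply Complex.ext
    · simp [← h]
    · simpa using h3

lemma log_bound {w : ℂ} {y : ℝ} (hy : 0 < y) (hy1 : y ≤ 1) (hw : ‖w‖ ≤ Real.exp (-y)) :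
    ‖Complex.log (1 + w)‖ ≤ bb y := by
  have h1 : y / 2 ≤ ‖1 + w‖ := by
    have h3 : Real.exp (-y) ≤ 1 - y/2 := by
      have := Real.exp_bound_div_one_sub_of_interval (x := y) 
      have h4 : Real.exp (-y) = (Real.exp y)⁻¹ := Real.exp_neg y
      have h5 : 1 + y ≤ Real.exp y := by linarith [Real.add_one_le_exp y]
      rw [h4, inv_le_comm₀ (Real.exp_pos _) (by linarith)]
      refine le_trans ?_ h5
      rw [inv_le_iff_one_le_mul₀ (by linarith)]
      nlinarith
    have := norm_sub_le_norm_add (1:ℂ) w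
    rw [norm_one] at this
    linarith
  have h2 : ‖1 + w‖ ≤ 2 := by
    have := norm_add_le (1:ℂ) w
    rw [norm_one] at this
    have : Real.exp (-y) ≤ 1 := Real.exp_le_one_iff.2 (by linarith)
    linarith
  have h3 : Real.log (y/2) ≤ Real.log ‖1 + w‖ := Real.log_le_log (by positivity) h1
  have h4 : Real.log ‖1 + w‖ ≤ Real.log 2 := Real.log_le_log (by linarith) h2
  rw [Real.log_div hy.ne' (by norm_num)] at h3
  have h5 := Complex.norm_le_abs_re_add_abs_im (Complex.log (1 + w))
  rw [Complex.log_re, Complex.log_im] at h5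
  have h6 := Complex.abs_arg_le_pi (1 + w)
  have h7 : Real.log y ≤ 0 := Real.log_nonpos hy.le hy1
  have h8 : 0 < Real.log 2 := Real.log_pos (by norm_num)
  have h9 : |Real.log ‖1 + w‖| ≤ 2 * Real.log 2 - Real.log y := by
    rw [abs_le]; constructor <;> linarith
  unfold bb
  linarith

/-- perturbation matrix -/
def Em (z s φ : ℂ) : CMat :=
  !![Complex.exp (-(Complex.I * z)) * Complex.cosh s, Complex.exp (-(Complex.I * z)) * (φ * Complex.sinh s);
     Complex.exp (Complex.I * z) * (star φ * Complex.sinh s), Complex.exp (Complex.I * z) * Complex.cosh s]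

lemma phase_mul {φ : ℂ} (hφ : ‖φ‖ = 1) : φ * star φ = 1 := by
  have : φ * star φ = ((Complex.normSq φ : ℝ) : ℂ) := Complex.mul_conj φ
  rw [this, Complex.normSq_eq_norm_sq, hφ]; simp

lemma Em_det (z s φ : ℂ) (hφ : ‖φ‖ = 1) : (Em z s φ).det = 1 := by
  rw [Matrix.det_fin_two]
  simp only [Em, Matrix.of_apply, Matrix.cons_val', Matrix.cons_val_zero, Matrix.cons_val_one, Matrix.cons_val_fin_one]
  have h1 : Complex.exp (-(Complex.I * z)) * Complex.exp (Complex.I * z) = 1 := by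
    rw [← Complex.exp_add]; simp
  have h2 := phase_mul hφ
  have h3 := Complex.cosh_sq_sub_sinh_sq s
  linear_combination (Complex.cosh s^2 - φ * star φ * Complex.sinh s^2) * h1 - Complex.sinh s^2 * h2 + h3

lemma normSq_form (a b u v : ℂ) : ‖a * u + b * v‖^2 - ‖star b * u + star a * v‖^2
    = (‖a‖^2 - ‖b‖^2) * (‖u‖^2 - ‖v‖^2) := by
  simp only [← Complex.normSq_eq_norm_sq, Complex.normSq_apply, Complex.add_re, Complex.add_im, Complex.mul_re, Complex.mul_im,
    Complex.star_def, Complex.conj_re, Complex.conj_im]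
  ring

lemma su_cone_aux (a b : ℂ) (h : ‖a‖^2 - ‖b‖^2 = 1) (u v : ℂ) (huv : ‖v‖ ≤ ‖u‖) :
    ‖star b * u + star a * v‖ ≤ ‖a * u + b * v‖ := by
  have h1 := normSq_form a b u v
  rw [h, one_mul] at h1
  have : ‖v‖^2 ≤ ‖u‖^2 := by gcongr
  apply le_of_sq_le_sq _ (norm_nonneg _)
  linarith

lemma H_cone (σ τ y : ℝ) (φ : ℂ) (hφ : ‖φ‖ = 1) (hy : 0 ≤ y) (hy1 : y ≤ 1) (hτ : |τ| ≤ y/8) (u v : ℂ) (huv : ‖v‖ ≤ ‖u‖) :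
    ‖star φ * Complex.sinh (σ + τ * Complex.I) * u + Complex.cosh (σ + τ * Complex.I) * v‖ ≤
      Real.exp y * ‖Complex.cosh (σ + τ * Complex.I) * u + φ * Complex.sinh (σ + τ * Complex.I) * v‖ := by
  -- first the real hyperbolic part
  set u' := ((Real.cosh σ : ℝ) : ℂ) * u + (φ * (Real.sinh σ : ℝ)) * v with hu'
  set v' := star (φ * ((Real.sinh σ : ℝ) : ℂ)) * u + star ((Real.cosh σ : ℝ) : ℂ) * v with hv'
  have h1 : ‖v'‖ ≤ ‖u'‖ := by
    apply su_cone_aux _ _ _ _ _ huv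
    rw [norm_mul, hφ, one_mul, Complex.norm_real, Complex.norm_real, Real.norm_eq_abs, Real.norm_eq_abs, sq_abs, sq_abs]
    exact Real.cosh_sq_sub_sinh_sq σ
  have hv2 : v' = (star φ * (Real.sinh σ : ℝ)) * u + ((Real.cosh σ : ℝ) : ℂ) * v := by
    rw [hv']
    simp only [star_mul', Complex.star_def, Complex.conj_ofReal]
  have hp := phase_mul hφ
  have e1 : Complex.cosh (σ + τ * Complex.I) * u + φ * Complex.sinh (σ + τ * Complex.I) * v
      = (Real.cos τ : ℝ) * u' + (Complex.I * φ * (Real.sin τ : ℝ)) * v' := by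
    rw [Complex.cosh_add, Complex.sinh_add, Complex.cosh_mul_I, Complex.sinh_mul_I, hu', hv2]
    push_cast
    linear_combination (-(Complex.I * Complex.sin τ * Complex.sinh σ * u)) * hp
  have e2 : star φ * Complex.sinh (σ + τ * Complex.I) * u + Complex.cosh (σ + τ * Complex.I) * v
      = (Complex.I * star φ * (Real.sin τ : ℝ)) * u' + (Real.cos τ : ℝ) * v' := by
    rw [Complex.cosh_add, Complex.sinh_add, Complex.cosh_mul_I, Complex.sinh_mul_I, hu', hv2]
    push_cast
    linear_combination (-(Complex.I * Complex.sin τ * Complex.sinh σ * v)) * hp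
  rw [e1, e2]
  have hsin : |Real.sin τ| ≤ y/8 := Real.abs_sin_le_abs.trans hτ
  have hcos : 99/100 ≤ Real.cos τ := by
    have := Real.one_sub_sq_div_two_le_cos (x := τ)
    have h3 : τ^2 ≤ (1/8)^2 := by
      rw [← sq_abs]; gcongr; linarith
    norm_num at h3
    linarith
  have hcos1 := Real.cos_le_one τ
  have hn : ‖(Complex.I * star φ * (Real.sin τ : ℝ)) * u' + (Real.cos τ : ℝ) * v'‖ ≤ (Real.cos τ + |Real.sin τ|) * ‖u'‖ := by
    refine (norm_add_le _ _).trans ?_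
    rw [norm_mul, norm_mul, norm_mul, norm_mul, norm_star, hφ, Complex.norm_I, Complex.norm_real, Complex.norm_real,
      Real.norm_eq_abs, Real.norm_eq_abs, abs_of_pos (by linarith : 0 < Real.cos τ)]
    nlinarith
  have hd : (Real.cos τ - |Real.sin τ|) * ‖u'‖ ≤ ‖(Real.cos τ : ℝ) * u' + (Complex.I * φ * (Real.sin τ : ℝ)) * v'‖ := by
    refine le_trans ?_ (norm_sub_le_norm_add _ _)
    rw [norm_mul, norm_mul, norm_mul, norm_mul, hφ, Complex.norm_I, Complex.norm_real, Complex.norm_real,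
      Real.norm_eq_abs, Real.norm_eq_abs, abs_of_pos (by linarith : 0 < Real.cos τ)]
    nlinarith [abs_nonneg (Real.sin τ)]
  refine hn.trans ?_
  have he : 1 + y ≤ Real.exp y := by linarith [Real.add_one_le_exp y]
  have h5 : (Real.cos τ + |Real.sin τ|) ≤ Real.exp y * (Real.cos τ - |Real.sin τ|) := by
    have h6 : 0 ≤ Real.cos τ - |Real.sin τ| := by linarith
    have h7 : (1+y) * (Real.cos τ - |Real.sin τ|) ≤ Real.exp y * (Real.cos τ - |Real.sin τ|) := by gcongr
    refine le_trans ?_ h7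
    nlinarith [abs_nonneg (Real.sin τ)]
  calc (Real.cos τ + |Real.sin τ|) * ‖u'‖ ≤ (Real.exp y * (Real.cos τ - |Real.sin τ|)) * ‖u'‖ := by gcongr
    _ = Real.exp y * ((Real.cos τ - |Real.sin τ|) * ‖u'‖) := by ring
    _ ≤ _ := by gcongr

lemma Em_cone {p : ℂ × ℂ} (hp : p ∈ Dom) (φ : ℂ) (hφ : ‖φ‖ = 1) : Cone (Real.exp (-p.1.im)) (Em p.1 p.2 φ) := by
  obtain ⟨z, s⟩ := p
  obtain ⟨h1, h2, h3, h4⟩ := hp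
  simp only at h1 h2 h3 h4 ⊢
  refine ⟨by rw [Em_det _ _ _ hφ]; exact one_ne_zero, fun u v huv => ?_⟩
  have hy1 : z.im ≤ 1 := by
    have := (Complex.abs_im_le_norm z); have := le_abs_self z.im; linarith
  have key := H_cone s.re s.im z.im φ hφ h1 hy1 h2 u v huv
  rw [Complex.re_add_im] at key
  simp only [Em, Matrix.of_apply, Matrix.cons_val', Matrix.cons_val_zero, Matrix.cons_val_one, Matrix.cons_val_fin_one]
  rw [show Complex.exp (Complex.I * z) * (star φ * Complex.sinh s) * u + Complex.exp (Complex.I * z) * Complex.cosh s * v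
    = Complex.exp (Complex.I * z) * (star φ * Complex.sinh s * u + Complex.cosh s * v) by ring,
    show Complex.exp (-(Complex.I * z)) * Complex.cosh s * u + Complex.exp (-(Complex.I * z)) * (φ * Complex.sinh s) * v
    = Complex.exp (-(Complex.I * z)) * (Complex.cosh s * u + φ * Complex.sinh s * v) by ring, norm_mul, norm_mul,
    Complex.norm_exp, Complex.norm_exp]
  have e1 : (Complex.I * z).re = -z.im := by simp
  have e2 : (-(Complex.I * z)).re = z.im := by simp
  rw [e1, e2, ← mul_assoc, ← Real.exp_add, neg_add_cancel, Real.exp_zero, one_mul]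
  calc _ ≤ Real.exp (-z.im) * (Real.exp z.im * ‖Complex.cosh s * u + φ * Complex.sinh s * v‖) := by gcongr
    _ = _ := by rw [← mul_assoc, ← Real.exp_add, neg_add_cancel, Real.exp_zero, one_mul]

/-- entries of the SU(1,1) form -/
def al (g : Mat2) : ℂ := ⟨(g 0 0 + g 1 1)/2, (g 1 0 - g 0 1)/2⟩
def be (g : Mat2) : ℂ := ⟨(g 0 0 - g 1 1)/2, (g 1 0 + g 0 1)/2⟩
def su (g : Mat2) : CMat := !![al g, be g; star (be g), star (al g)]

lemma su_mul (g h : Mat2) : su (g * h) = su g * su h := by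
  ext i j
  fin_cases i <;> fin_cases j <;>
  · apply Complex.ext <;>
    simp [su, al, be, Matrix.mul_apply, Fin.sum_univ_two] <;> ring

lemma su_one : su 1 = 1 := by
  ext i j
  fin_cases i <;> fin_cases j <;>
  · apply Complex.ext <;>
    simp [su, al, be]

lemma al_be (g : Mat2) (hg : g.det = 1) : ‖al g‖^2 - ‖be g‖^2 = 1 := by
  rw [Matrix.det_fin_two] at hg
  simp only [← Complex.normSq_eq_norm_sq, Complex.normSq_apply, al, be]
  linear_combination hg

lemma su_cone (g : Mat2) (hg : g.det = 1) : Cone 1 (su g) := by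
  refine ⟨?_, fun u v huv => ?_⟩
  · have h1 := al_be g hg
    rw [Matrix.det_fin_two]
    simp only [su, Matrix.of_apply, Matrix.cons_val', Matrix.cons_val_zero, Matrix.cons_val_one, Matrix.cons_val_fin_one]
    have e1 : al g * star (al g) = ((‖al g‖^2 : ℝ) : ℂ) := by rw [← Complex.normSq_eq_norm_sq]; exact Complex.mul_conj _
    have e2 : be g * star (be g) = ((‖be g‖^2 : ℝ) : ℂ) := by rw [← Complex.normSq_eq_norm_sq]; exact Complex.mul_conj _
    rw [e1, e2, ← Complex.ofReal_sub, h1]; simp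
  · rw [one_mul]
    exact su_cone_aux (al g) (be g) (al_be g hg) u v huv

section cocycle
variable {X : Type*}

/-- complexified cocycle -/
def CM (T : X → X) (A : X → Mat2) (φ : X → ℂ) : ℕ → ℂ × ℂ → X → CMat
  | 0, _, _ => 1
  | n + 1, p, x => CM T A φ n p (T x) * (Em p.1 p.2 (φ x) * su (A x))

lemma CM_add (T : X → X) (A : X → Mat2) (φ : X → ℂ) (n m : ℕ) (p : ℂ × ℂ) (x : X) :
    CM T A φ (n + m) p x = CM T A φ n p (T^[m] x) * CM T A φ m p x := by
  induction m generalizing x with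
  | zero => simp [CM]
  | succ m ih =>
    rw [← add_assoc, CM, ih, CM, Function.iterate_succ_apply, Matrix.mul_assoc]

def ff (T : X → X) (A : X → Mat2) (φ : X → ℂ) (n : ℕ) (p : ℂ × ℂ) (x : X) : ℂ := CM T A φ n p x 0 0

def Qf (T : X → X) (A : X → Mat2) (φ : X → ℂ) (n : ℕ) (p : ℂ × ℂ) (x : X) : ℂ :=
  ff T A φ (n + n) p x / (ff T A φ n p (T^[n] x) * ff T A φ n p x)

variable {T : X → X} {A : X → Mat2} {φ : X → ℂ}

lemma CM_step_cone (hA : ∀ x, (A x).det = 1) (hφ : ∀ x, ‖φ x‖ = 1) {p : ℂ × ℂ} (hp : p ∈ Dom) (x : X) :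
    Cone (Real.exp (-p.1.im)) (Em p.1 p.2 (φ x) * su (A x)) :=
  (Em_cone hp _ (hφ x)).mul (su_cone _ (hA x))

lemma kle {p : ℂ × ℂ} (hp : p ∈ Dom) : Real.exp (-p.1.im) ≤ 1 := Real.exp_le_one_iff.2 (by linarith [hp.1])

lemma CM_cone (hA : ∀ x, (A x).det = 1) (hφ : ∀ x, ‖φ x‖ = 1) {p : ℂ × ℂ} (hp : p ∈ Dom) (n : ℕ) (x : X) :
    Cone 1 (CM T A φ n p x) := by
  induction n generalizing x with
  | zero => exact Cone.one
  | succ n ih => exact (ih (T x)).mul ((CM_step_cone hA hφ hp x).mono (kle hp))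

lemma CM_cone' (hA : ∀ x, (A x).det = 1) (hφ : ∀ x, ‖φ x‖ = 1) {p : ℂ × ℂ} (hp : p ∈ Dom) (n : ℕ) (x : X) :
    Cone (Real.exp (-p.1.im)) (CM T A φ (n+1) p x) := by
  induction n generalizing x with
  | zero => simpa [CM] using CM_step_cone hA hφ hp x
  | succ n ih => exact (ih (T x)).mul ((CM_step_cone hA hφ hp x).mono (kle hp))

lemma ff_ne (hA : ∀ x, (A x).det = 1) (hφ : ∀ x, ‖φ x‖ = 1) {p : ℂ × ℂ} (hp : p ∈ Dom) (n : ℕ) (x : X) :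
    ff T A φ n p x ≠ 0 := (CM_cone hA hφ hp n x).ne_zero

lemma Qf_form (hA : ∀ x, (A x).det = 1) (hφ : ∀ x, ‖φ x‖ = 1) {p : ℂ × ℂ} (hp : p ∈ Dom) (n : ℕ) (hn : 0 < n) (x : X) :
    ∃ w : ℂ, ‖w‖ ≤ Real.exp (-p.1.im) ∧ w ≠ -1 ∧ Qf T A φ n p x = 1 + w := by
  obtain ⟨m, rfl⟩ : ∃ m, n = m + 1 := ⟨n - 1, by omega⟩
  obtain ⟨w, h1, h2, h3⟩ := ratio_form (kle hp) (CM_cone (T := T) hA hφ hp (m+1) (T^[m+1] x)) (CM_cone' (T := T) hA hφ hp m x)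
  refine ⟨w, h1, h2, ?_⟩
  rw [← h3, ← CM_add]; rfl

lemma Em_diff (φ : ℂ) (i j : Fin 2) : Differentiable ℂ (fun p : ℂ × ℂ => Em p.1 p.2 φ i j) := by
  have h1 : Differentiable ℂ (fun p : ℂ × ℂ => p.1) := differentiable_fst
  have h2 : Differentiable ℂ (fun p : ℂ × ℂ => p.2) := differentiable_snd
  have e1 := (h1.const_mul Complex.I).cexp
  have e2 := (h1.const_mul Complex.I).neg.cexp
  have c := h2.ccosh
  have s := h2.csinh
  fin_cases i <;> fin_cases j <;> simp [Em]
  · exact e2.mul c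
  · exact e2.mul (s.const_mul φ)
  · exact e1.mul (s.const_mul _)
  · exact e1.mul c

lemma CM_diff (n : ℕ) (x : X) (i j : Fin 2) : Differentiable ℂ (fun p => CM T A φ n p x i j) := by
  induction n generalizing x i j with
  | zero => simp [CM]
  | succ n ih =>
    simp only [CM, Matrix.mul_apply, Fin.sum_univ_two]
    have a := ih (T x) i 0
    have b := ih (T x) i 1
    exact (a.mul (((Em_diff (φ x) 0 0).mul_const _).add ((Em_diff (φ x) 0 1).mul_const _))).add
      (b.mul (((Em_diff (φ x) 1 0).mul_const _).add ((Em_diff (φ x) 1 1).mul_const _)))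

variable [TopologicalSpace X]

lemma su_cont (hA : Continuous A) : Continuous (fun x => su (A x)) := by
  have h : ∀ i j, Continuous fun x => A x i j := fun i j => (continuous_apply_apply i j).comp hA
  have ha : Continuous fun x => al (A x) := by
    have : (fun x => al (A x)) = fun x => (((A x 0 0 + A x 1 1)/2 : ℝ) : ℂ) + (((A x 1 0 - A x 0 1)/2 : ℝ) : ℂ) * Complex.I := by
      ext x; apply Complex.ext <;> simp [al]
    rw [this]
    have := h 0 0; have := h 0 1; have := h 1 0; have := h 1 1
    fun_prop
  have hb : Continuous fun x => be (A x) := by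
    have : (fun x => be (A x)) = fun x => (((A x 0 0 - A x 1 1)/2 : ℝ) : ℂ) + (((A x 1 0 + A x 0 1)/2 : ℝ) : ℂ) * Complex.I := by
      ext x; apply Complex.ext <;> simp [be]
    rw [this]
    have := h 0 0; have := h 0 1; have := h 1 0; have := h 1 1
    fun_prop
  apply continuous_matrix
  intro i j
  fin_cases i <;> fin_cases j <;> simp [su]
  · exact ha
  · exact hb
  · exact Complex.continuous_conj.comp hb
  · exact Complex.continuous_conj.comp ha

lemma Em_cont (hφ : Continuous φ) : Continuous (fun q : (ℂ × ℂ) × X => Em q.1.1 q.1.2 (φ q.2)) := by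
  have h3 : Continuous fun q : (ℂ × ℂ) × X => φ q.2 := hφ.comp continuous_snd
  have h4 : Continuous fun q : (ℂ × ℂ) × X => (starRingEnd ℂ) (φ q.2) := Complex.continuous_conj.comp h3
  apply continuous_matrix
  intro i j
  fin_cases i <;> fin_cases j <;> simp [Em] <;> fun_prop

lemma CM_cont (hT : Continuous T) (hA : Continuous A) (hφ : Continuous φ) (n : ℕ) :
    Continuous (fun q : (ℂ × ℂ) × X => CM T A φ n q.1 q.2) := by
  induction n with
  | zero => exact continuous_const
  | succ n ih =>
    simp only [CM]
    have h1 : Continuous (fun q : (ℂ × ℂ) × X => CM T A φ n q.1 (T q.2)) :=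
      ih.comp (by fun_prop : Continuous fun q : (ℂ × ℂ) × X => (q.1, T q.2))
    exact h1.matrix_mul ((Em_cont hφ).matrix_mul ((su_cont hA).comp continuous_snd))

lemma ff_cont (hT : Continuous T) (hA : Continuous A) (hφ : Continuous φ) (n : ℕ) :
    Continuous (fun q : (ℂ × ℂ) × X => ff T A φ n q.1 q.2) :=
  (continuous_apply_apply 0 0).comp (CM_cont hT hA hφ n)

lemma goodG_log {F : ℂ × ℂ → X → ℂ} (hc : ContinuousOn (Function.uncurry F) (Dom ×ˢ Set.univ))
    (hd : ∀ x, ∀ p ∈ Dom, DifferentiableAt ℂ (fun p => F p x) p)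
    (hs : ∀ x, ∀ p ∈ Dom, F p x ∈ Complex.slitPlane) : GoodG (fun p x => Complex.log (F p x)) where
  cont := by
    have := hc.clog (fun q hq => hs q.2 q.1 hq.1)
    exact this
  diff := fun x p hp => (hd x p hp).clog (hs x p hp)

lemma goodG_Q (hT : Continuous T) (hA : Continuous A) (hφ : Continuous φ)
    (hA1 : ∀ x, (A x).det = 1) (hφ1 : ∀ x, ‖φ x‖ = 1) (n : ℕ) (hn : 0 < n) :
    GoodG (fun p x => Complex.log (Qf T A φ n p x)) := by
  apply goodG_log
  · have h1 : Continuous (fun q : (ℂ × ℂ) × X => ff T A φ n q.1 (T^[n] q.2)) :=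
      (ff_cont hT hA hφ n).comp ((continuous_fst).prodMk ((hT.iterate n).comp continuous_snd))
    refine ContinuousOn.div (ff_cont hT hA hφ (n+n)).continuousOn
      (h1.mul (ff_cont hT hA hφ n)).continuousOn ?_
    intro q hq
    exact mul_ne_zero (ff_ne hA1 hφ1 hq.1 _ _) (ff_ne hA1 hφ1 hq.1 _ _)
  · intro x p hp
    have h1 : DifferentiableAt ℂ (fun p => ff T A φ (n+n) p x) p := (CM_diff (n+n) x 0 0) p
    have h2 : DifferentiableAt ℂ (fun p => ff T A φ n p (T^[n] x) * ff T A φ n p x) p :=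
      ((CM_diff n (T^[n] x) 0 0) p).mul ((CM_diff n x 0 0) p)
    have h3 : ff T A φ n p (T^[n] x) * ff T A φ n p x ≠ 0 :=
      mul_ne_zero (ff_ne hA1 hφ1 hp _ _) (ff_ne hA1 hφ1 hp _ _)
    have h4 := h1.mul (h2.inv h3)
    exact h4
  · intro x p hp
    obtain ⟨w, h1, h2, h3⟩ := Qf_form (T := T) hA1 hφ1 hp n hn x
    rw [h3]
    exact slit_of_form (h1.trans (kle hp)) h2

lemma Em00_slit {p : ℂ × ℂ} (hp : p ∈ Dom) (φ : ℂ) : Em p.1 p.2 φ 0 0 ∈ Complex.slitPlane := by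
  obtain ⟨z, s⟩ := p
  obtain ⟨_, _, h3, h4⟩ := hp
  simp only at h3 h4
  have e1 : ‖Complex.exp (-(Complex.I * z)) - 1‖ ≤ 1/8 := by
    have := Complex.norm_exp_sub_one_le (x := -(Complex.I * z)) (by simp; linarith)
    simp at this; linarith
  have e2 : ‖Complex.exp s - 1‖ ≤ 1/8 := by
    have := Complex.norm_exp_sub_one_le (x := s) (by linarith); linarith
  have e3 : ‖Complex.exp (-s) - 1‖ ≤ 1/8 := by
    have := Complex.norm_exp_sub_one_le (x := -s) (by rw [norm_neg]; linarith)
    rw [norm_neg] at this; linarith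
  have e4 : ‖Complex.cosh s - 1‖ ≤ 1/8 := by
    have : Complex.cosh s - 1 = (1/2) * (Complex.exp s - 1) + (1/2) * (Complex.exp (-s) - 1) := by
      rw [Complex.cosh]; ring
    rw [this]
    refine (norm_add_le _ _).trans ?_
    rw [norm_mul, norm_mul]; norm_num; linarith
  simp only [Em, Matrix.of_apply, Matrix.cons_val', Matrix.cons_val_zero, Matrix.cons_val_fin_one]
  set a := Complex.exp (-(Complex.I * z))
  set b := Complex.cosh s
  have e5 : ‖a * b - 1‖ ≤ 1/2 := by
    have : a * b - 1 = (a - 1) * (b - 1) + (a - 1) + (b - 1) := by ring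
    rw [this]
    refine (norm_add_le _ _).trans ((add_le_add_left (norm_add_le _ _) _).trans ?_)
    rw [norm_mul]
    nlinarith [norm_nonneg (a-1), norm_nonneg (b-1)]
  left
  have := (Complex.abs_re_le_norm (a * b - 1)).trans e5
  have := (abs_le.1 this).1
  simp only [Complex.sub_re, Complex.one_re] at this
  linarith

def Pf (A : X → Mat2) (φ : X → ℂ) (p : ℂ × ℂ) (x : X) : ℂ :=
  (Em p.1 p.2 (φ x) * su (A x)) 0 0 / (Em p.1 p.2 (φ x) 0 0 * su (A x) 0 0)

lemma goodG_P (hA : Continuous A) (hφ : Continuous φ)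
    (hA1 : ∀ x, (A x).det = 1) (hφ1 : ∀ x, ‖φ x‖ = 1)  :
    GoodG (fun p x => Complex.log (Pf A φ p x)) := by
  have hne : ∀ p ∈ Dom, ∀ x, Em p.1 p.2 (φ x) 0 0 * su (A x) 0 0 ≠ 0 := fun p hp x =>
    mul_ne_zero (Em_cone hp _ (hφ1 x)).ne_zero (su_cone _ (hA1 x)).ne_zero
  apply goodG_log
  · have h1 := (continuous_apply_apply 0 0).comp ((Em_cont hφ).matrix_mul ((su_cont hA).comp continuous_snd))
    have h2 := (continuous_apply_apply 0 0).comp (Em_cont hφ)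
    have h3 := (continuous_apply_apply 0 0).comp ((su_cont hA).comp (continuous_snd (X := ℂ × ℂ)))
    refine ContinuousOn.div h1.continuousOn (h2.mul h3).continuousOn ?_
    intro q hq
    exact hne q.1 hq.1 q.2
  · intro x p hp
    have h1 : DifferentiableAt ℂ (fun p : ℂ × ℂ => (Em p.1 p.2 (φ x) * su (A x)) 0 0) p := by
      simp only [Matrix.mul_apply, Fin.sum_univ_two]
      exact (((Em_diff (φ x) 0 0).mul_const _).add ((Em_diff (φ x) 0 1).mul_const _)) p
    have h2 : DifferentiableAt ℂ (fun p : ℂ × ℂ => Em p.1 p.2 (φ x) 0 0 * su (A x) 0 0) p :=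
      ((Em_diff (φ x) 0 0).mul_const _) p
    have h4 := h1.mul (h2.inv (hne p hp x))
    exact h4
  · intro x p hp
    obtain ⟨w, h1, h2, h3⟩ := ratio_form le_rfl ((Em_cone hp _ (hφ1 x)).mono (kle hp)) (su_cone _ (hA1 x))
    rw [Pf, h3]
    exact slit_of_form h1 h2

lemma goodG_E (hφ : Continuous φ) :
    GoodG (fun p x => Complex.log (Em p.1 p.2 (φ x) 0 0)) := by
  apply goodG_log
  · exact ((continuous_apply_apply 0 0).comp (Em_cont hφ)).continuousOn
  · intro x p hp
    exact Em_diff (φ x) 0 0 p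
  · intro x p hp
    exact Em00_slit hp _

end cocycle

lemma analytic_ext_lemma (S : ℕ → ℝ → ℝ) (h : ℕ → ℂ → ℂ) (h0 : ℂ → ℂ) (c C : ℝ)
    (hS0 : ∀ lam : ℝ, |lam| < 2 → S 0 lam = c + (h0 lam).re)
    (hS : ∀ k, ∀ lam : ℝ, |lam| < 2 → S (k+1) lam = 2 * S k lam + (h k lam).re)
    (hd0 : DifferentiableOn ℂ h0 (Metric.ball 0 2))
    (hd : ∀ k, DifferentiableOn ℂ (h k) (Metric.ball 0 2))
    (hb : ∀ k, ∀ lam ∈ Metric.ball (0:ℂ) 2, ‖h k lam‖ ≤ C)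
    (δ : ℝ) (hδ : 0 < δ)
    (hlim : ∀ lam : ℝ, |lam| < δ → Filter.Tendsto (fun k => S k lam / 2^k) Filter.atTop (nhds 0)) :
    ∀ k, S k 1 ≤ C := by
  have hsum : Summable (fun k : ℕ => C / 2^(k+1)) := by
    have := (summable_geometric_two.mul_left (C/2))
    refine this.congr ?_
    intro k; rw [pow_succ, one_div, inv_pow]; field_simp
  have hbk : ∀ k, ∀ lam ∈ Metric.ball (0:ℂ) 2, ‖h k lam / 2^(k+1)‖ ≤ C / 2^(k+1) := by
    intro k lam hl
    rw [norm_div, norm_pow]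
    simp only [Complex.norm_ofNat]
    gcongr
    exact hb k lam hl
  let Ψ : ℂ → ℂ := fun lam => h0 lam + ∑' k, h k lam / 2^(k+1)
  have hΨ : DifferentiableOn ℂ Ψ (Metric.ball 0 2) :=
    hd0.add (Complex.differentiableOn_tsum_of_summable_norm hsum (fun k => (hd k).div_const _)
      Metric.isOpen_ball hbk)
  have hmem : ∀ lam : ℝ, |lam| < 2 → (lam : ℂ) ∈ Metric.ball (0:ℂ) 2 := by
    intro lam hl; simpa [Complex.norm_real] using hl
  let u : ℝ → ℝ := fun lam => c + (Ψ lam).re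
  have hSk : ∀ k, ∀ lam : ℝ, |lam| < 2 → S k lam / 2^k = c + (h0 lam + ∑ j ∈ Finset.range k, h j lam / 2^(j+1)).re := by
    intro k lam hl
    induction k with
    | zero => simp [hS0 lam hl]
    | succ k ih =>
      rw [Finset.sum_range_succ, ← add_assoc, Complex.add_re _ (h k lam / 2^(k+1)), ← add_assoc, ← ih, hS k lam hl]
      have : (h k lam / 2^(k+1)).re = (h k lam).re / 2^(k+1) := by
        rw [← Complex.ofReal_ofNat, ← Complex.ofReal_pow, Complex.div_ofReal_re]
      rw [this]; field_simp; ring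
  have htend : ∀ lam : ℝ, |lam| < 2 → Filter.Tendsto (fun k => S k lam / 2^k) Filter.atTop (nhds (u lam)) := by
    intro lam hl
    have hs : Summable (fun k => h k lam / 2^(k+1)) :=
      Summable.of_norm_bounded hsum (fun k => hbk k lam (hmem lam hl))
    have h1 := hs.hasSum.tendsto_sum_nat
    have h2 := (Complex.continuous_re.tendsto _).comp (h1.const_add (h0 lam))
    have h3 := h2.const_add c
    refine h3.congr ?_
    intro k; rw [hSk k lam hl]; rfl
  have han : AnalyticOnNhd ℝ u (Set.Ioo (-2) 2) := by
    intro lam hl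
    have hl2 : |lam| < 2 := abs_lt.2 hl
    have a1 : AnalyticAt ℂ Ψ (lam : ℂ) := hΨ.analyticAt (Metric.isOpen_ball.mem_nhds (hmem lam hl2))
    have a2 : AnalyticAt ℝ Ψ (lam : ℂ) := a1.restrictScalars
    have a3 : AnalyticAt ℝ (fun t : ℝ => Ψ (t : ℂ)) lam :=
      AnalyticAt.comp (g := Ψ) (f := fun t : ℝ => (t:ℂ)) a2 (Complex.ofRealCLM.analyticAt lam)
    have a4 : AnalyticAt ℝ (fun t : ℝ => (Ψ (t : ℂ)).re) lam :=
      AnalyticAt.comp (g := fun z : ℂ => z.re) (f := fun t : ℝ => Ψ (t : ℂ)) (Complex.reCLM.analyticAt _) a3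
    exact analyticAt_const.add a4
  have hz : Set.EqOn u 0 (Set.Ioo (-2) 2) := by
    refine han.eqOn_of_preconnected_of_eventuallyEq (fun _ _ => analyticAt_const) isPreconnected_Ioo
      (z₀ := 0) (by simp) ?_
    have : Set.Ioo (-(min δ 2)) (min δ 2) ∈ nhds (0:ℝ) :=
      isOpen_Ioo.mem_nhds ⟨by simp [hδ], by simp [hδ]⟩
    filter_upwards [this] with lam hl
    have hl := abs_lt.2 hl
    exact tendsto_nhds_unique (htend lam (hl.trans_le (min_le_right _ _))) (hlim lam (hl.trans_le (min_le_left _ _)))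
  intro k
  have h1 := htend 1 (by norm_num)
  have hu : u 1 = 0 := hz (by norm_num)
  rw [hu] at h1
  have hlow : ∀ m, (S k 1 - C) / 2^k ≤ S (m+k) 1 / 2^(m+k) - C / 2^(m+k) := by
    intro m
    induction m with
    | zero => simp [sub_div]
    | succ m ih =>
      refine ih.trans ?_
      have e : m + 1 + k = (m + k) + 1 := by ring
      rw [e, hS (m+k) 1 (by norm_num)]
      have := (abs_le.1 ((Complex.abs_re_le_norm _).trans (hb (m+k) ((1:ℝ):ℂ) (hmem 1 (by norm_num))))).1
      rw [← sub_div, ← sub_div, div_le_div_iff₀ (by positivity) (by positivity), pow_succ]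
      have : (0:ℝ) < 2^(m+k) := by positivity
      nlinarith
  have h2 : Filter.Tendsto (fun m => S (m+k) 1 / 2^(m+k) - C / 2^(m+k)) Filter.atTop (nhds 0) := by
    have a1 := (Filter.tendsto_add_atTop_iff_nat k).2 h1
    have a2 : Filter.Tendsto (fun m : ℕ => C / (2:ℝ)^(m+k)) Filter.atTop (nhds 0) := by
      apply (Filter.tendsto_add_atTop_iff_nat (f := fun m : ℕ => C / (2:ℝ)^m) k).2
      exact tendsto_const_nhds.div_atTop (tendsto_pow_atTop_atTop_of_one_lt (by norm_num))
    simpa using a1.sub a2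
  have h3 := ge_of_tendsto' h2 hlow
  have : (0:ℝ) < 2^k := by positivity
  rw [div_le_iff₀ this] at h3
  linarith

set_option linter.unusedSectionVars false
section
variable {X : Type*} [TopologicalSpace X] [CompactSpace X] [MeasurableSpace X] [OpensMeasurableSpace X]
  [SecondCountableTopology X] (μ : Measure X) [IsProbabilityMeasure μ] {T : X → X} {A : X → Mat2} {φ : X → ℂ}

def vv (T : X → X) (A : X → Mat2) (φ : X → ℂ) (n : ℕ) (p : ℂ × ℂ) : ℝ := ∫ x, Real.log ‖ff T A φ n p x‖ ∂μ

def SS (T : X → X) (A : X → Mat2) (φ : X → ℂ) (η : ℝ) (k : ℕ) (lam : ℝ) : ℝ :=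
  ∫ t in (-η)..η, vv μ T A φ (2^k) ((t:ℂ), lam * qf η t)

lemma logff_contOn (hT : Continuous T) (hA : Continuous A) (hφ : Continuous φ)
    (hA1 : ∀ x, (A x).det = 1) (hφ1 : ∀ x, ‖φ x‖ = 1) (n : ℕ) :
    ContinuousOn (Function.uncurry fun p x => Real.log ‖ff T A φ n p x‖) (Dom ×ˢ Set.univ) := by
  have := (ff_cont hT hA hφ n).norm.continuousOn (s := Dom ×ˢ Set.univ)
  exact this.log (fun q hq => by simpa using ff_ne hA1 hφ1 hq.1 n q.2)

lemma logff_cont (hT : Continuous T) (hA : Continuous A) (hφ : Continuous φ)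
    (hA1 : ∀ x, (A x).det = 1) (hφ1 : ∀ x, ‖φ x‖ = 1) (n : ℕ) {p : ℂ × ℂ} (hp : p ∈ Dom) :
    Continuous (fun x => Real.log ‖ff T A φ n p x‖) := by
  have h1 : Continuous fun x => ff T A φ n p x := (ff_cont hT hA hφ n).comp (by fun_prop : Continuous fun x : X => (p, x))
  exact h1.norm.log (fun x => by simpa using ff_ne hA1 hφ1 hp n x)

lemma integrable_of_cont {f : X → ℝ} (hf : Continuous f) : Integrable f μ := by
  obtain ⟨M, hM⟩ := isCompact_univ.exists_bound_of_continuousOn hf.continuousOn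
  exact Integrable.of_bound hf.aestronglyMeasurable M (Filter.Eventually.of_forall fun x => hM x trivial)

lemma integrable_of_contC {f : X → ℂ} (hf : Continuous f) : Integrable f μ := by
  obtain ⟨M, hM⟩ := isCompact_univ.exists_bound_of_continuousOn hf.continuousOn
  exact Integrable.of_bound hf.aestronglyMeasurable M (Filter.Eventually.of_forall fun x => hM x trivial)

lemma vv_contOn (hT : Continuous T) (hA : Continuous A) (hφ : Continuous φ)
    (hA1 : ∀ x, (A x).det = 1) (hφ1 : ∀ x, ‖φ x‖ = 1) (n : ℕ) :
    ContinuousOn (vv μ T A φ n) Dom :=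
  continuousOn_integral_of_compact_support isCompact_univ (logff_contOn hT hA hφ hA1 hφ1 n) (by simp)

lemma real_path_mem (η : ℝ) (hη : 0 < η) (hη2 : η ≤ 1/100) (lam : ℝ) (hl : |lam| ≤ 2) (t : ℝ) (ht : t ∈ Set.Icc (-η) η) :
    ((t:ℂ), (lam:ℂ) * qf η t) ∈ Dom := by
  have := mem_Dom_real η t 0 lam hη hη2 (abs_le.2 ht) le_rfl hη.le hl
  simpa using this

lemma path_cont {g : ℂ × ℂ → ℝ} (hg : ContinuousOn g Dom) (η : ℝ) (hη : 0 < η) (hη2 : η ≤ 1/100) (lam : ℝ) (hl : |lam| ≤ 2) :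
    ContinuousOn (fun t : ℝ => g ((t:ℂ), (lam:ℂ) * qf η t)) (Set.Icc (-η) η) :=
  hg.comp (Continuous.continuousOn (by unfold qf; fun_prop)) (fun t ht => real_path_mem η hη hη2 lam hl t ht)

lemma path_contC {g : ℂ × ℂ → ℂ} (hg : ContinuousOn g Dom) (η : ℝ) (hη : 0 < η) (hη2 : η ≤ 1/100) (lam : ℝ) (hl : |lam| ≤ 2) :
    ContinuousOn (fun t : ℝ => g ((t:ℂ), (lam:ℂ) * qf η t)) (Set.Icc (-η) η) :=
  hg.comp (Continuous.continuousOn (by unfold qf; fun_prop)) (fun t ht => real_path_mem η hη hη2 lam hl t ht)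

lemma re_integral (f : X → ℂ) (hf : Continuous f) : ∫ x, (f x).re ∂μ = (∫ x, f x ∂μ).re := by
  have := Complex.reCLM.integral_comp_comm (integrable_of_contC μ hf)
  simpa using this

lemma re_integral_t (f : ℝ → ℂ) (η : ℝ) (hη : 0 < η) (hf : ContinuousOn f (Set.Icc (-η) η)) :
    ∫ t in (-η)..η, (f t).re = (∫ t in (-η)..η, f t).re := by
  have h := Complex.reCLM.intervalIntegral_comp_comm (a := -η) (b := η) (μ := volume) (f := f)
    (ContinuousOn.intervalIntegrable (by rwa [Set.uIcc_of_le (by linarith)]))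
  simpa using h

lemma vv_double (hT : Continuous T) (hTm : MeasurePreserving T μ μ) (hA : Continuous A) (hφ : Continuous φ)
    (hA1 : ∀ x, (A x).det = 1) (hφ1 : ∀ x, ‖φ x‖ = 1) (n : ℕ) (hn : 0 < n) {p : ℂ × ℂ} (hp : p ∈ Dom) :
    vv μ T A φ (n + n) p = 2 * vv μ T A φ n p + (∫ x, Complex.log (Qf T A φ n p x) ∂μ).re := by
  have hc := logff_cont hT hA hφ hA1 hφ1 n hp
  have hg := goodG_Q hT hA hφ hA1 hφ1 n hn
  rw [← re_integral μ _ (hg.cont_x hp)]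
  have h1 : ∀ x, Real.log ‖ff T A φ (n+n) p x‖ = Real.log ‖ff T A φ n p (T^[n] x)‖ + Real.log ‖ff T A φ n p x‖
      + (Complex.log (Qf T A φ n p x)).re := by
    intro x
    rw [Complex.log_re, Qf, norm_div, norm_mul]
    have e1 := norm_ne_zero_iff.2 (ff_ne (T := T) hA1 hφ1 hp n x)
    have e2 := norm_ne_zero_iff.2 (ff_ne (T := T) hA1 hφ1 hp n (T^[n] x))
    have e3 := norm_ne_zero_iff.2 (ff_ne (T := T) hA1 hφ1 hp (n+n) x)
    rw [Real.log_div e3 (mul_ne_zero e2 e1), Real.log_mul e2 e1]; ring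
  have h2 : ∫ x, Real.log ‖ff T A φ n p (T^[n] x)‖ ∂μ = vv μ T A φ n p := by
    have hm := hTm.iterate n
    have := integral_map (μ := μ) (φ := T^[n]) hm.measurable.aemeasurable (f := fun x => Real.log ‖ff T A φ n p x‖)
      (by rw [hm.map_eq]; exact hc.aestronglyMeasurable)
    rw [hm.map_eq] at this
    exact this.symm
  unfold vv
  simp_rw [h1]
  have i1 : Integrable (fun x => Real.log ‖ff T A φ n p (T^[n] x)‖) μ := integrable_of_cont μ (hc.comp (hT.iterate n))
  have i2 := integrable_of_cont μ hc
  have i3 : Integrable (fun x => (Complex.log (Qf T A φ n p x)).re) μ :=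
    integrable_of_cont μ (Complex.continuous_re.comp (hg.cont_x hp))
  have e1 := integral_add (i1.add i2) i3
  simp only [Pi.add_apply] at e1
  rw [e1, integral_add i1 i2, h2]
  unfold vv; ring

lemma vv_one (hA : Continuous A) (hφ : Continuous φ)
    (hA1 : ∀ x, (A x).det = 1) (hφ1 : ∀ x, ‖φ x‖ = 1) {p : ℂ × ℂ} (hp : p ∈ Dom) :
    vv μ T A φ 1 p = (∫ x, Real.log ‖su (A x) 0 0‖ ∂μ) + (∫ x, Complex.log (Em p.1 p.2 (φ x) 0 0) ∂μ).re
      + (∫ x, Complex.log (Pf A φ p x) ∂μ).re := by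
  have hg := goodG_P hA hφ hA1 hφ1
  have hg2 := goodG_E hφ
  rw [← re_integral μ _ (hg.cont_x hp), ← re_integral μ _ (hg2.cont_x hp)]
  have e2 : ∀ x, ‖su (A x) 0 0‖ ≠ 0 := fun x => norm_ne_zero_iff.2 (su_cone _ (hA1 x)).ne_zero
  have h1 : ∀ x, Real.log ‖ff T A φ 1 p x‖ = Real.log ‖su (A x) 0 0‖ + (Complex.log (Em p.1 p.2 (φ x) 0 0)).re
      + (Complex.log (Pf A φ p x)).re := by
    intro x
    rw [Complex.log_re, Complex.log_re, Pf, norm_div, norm_mul]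
    have e1 := norm_ne_zero_iff.2 (Em_cone hp _ (hφ1 x)).ne_zero
    have e3 := norm_ne_zero_iff.2 (ff_ne (T := T) hA1 hφ1 hp 1 x)
    have e4 : ff T A φ 1 p x = (Em p.1 p.2 (φ x) * su (A x)) 0 0 := by simp [ff, CM]
    rw [← e4, Real.log_div e3 (mul_ne_zero e1 (e2 x)), Real.log_mul e1 (e2 x)]; ring
  unfold vv
  simp_rw [h1]
  have c1 : Continuous fun x => Real.log ‖su (A x) 0 0‖ :=
    (((continuous_apply_apply 0 0).comp (su_cont hA)).norm).log e2
  have i1 := integrable_of_cont μ c1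
  have i2 := integrable_of_cont μ (Complex.continuous_re.comp (hg2.cont_x hp))
  have i3 := integrable_of_cont μ (Complex.continuous_re.comp (hg.cont_x hp))
  have := integral_add (i1.add i2) i3
  simp only [Function.comp, Pi.add_apply] at this
  rw [this]
  have := integral_add i1 i2
  simp only [Function.comp] at this
  rw [this]

theorem SS_bound (hT : Continuous T) (hTm : MeasurePreserving T μ μ) (hA : Continuous A) (hφ : Continuous φ)
    (hA1 : ∀ x, (A x).det = 1) (hφ1 : ∀ x, ‖φ x‖ = 1) (η : ℝ) (hη : 0 < η) (hη2 : η ≤ 1/100)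
    (δ : ℝ) (hδ : 0 < δ)
    (hlim : ∀ lam : ℝ, |lam| < δ → Filter.Tendsto (fun k => SS μ T A φ η k lam / 2^k) Filter.atTop (nhds 0)) :
    ∀ k, SS μ T A φ η k 1 ≤ CC η := by
  have gP := goodG_P hA hφ hA1 hφ1
  have gE := goodG_E hφ
  have gQ := fun k : ℕ => goodG_Q hT hA hφ hA1 hφ1 (2^k) (by positivity)
  have hIcc : Set.uIcc (-η) η = Set.Icc (-η) η := Set.uIcc_of_le (by linarith)
  refine analytic_ext_lemma (fun k lam => SS μ T A φ η k lam)
    (fun k => contour η (fun p => ∫ x, Complex.log (Qf T A φ (2^k) p x) ∂μ))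
    (fun lam => contour η (fun p => ∫ x, Complex.log (Em p.1 p.2 (φ x) 0 0) ∂μ) lam +
      contour η (fun p => ∫ x, Complex.log (Pf A φ p x) ∂μ) lam)
    (2 * η * ∫ x, Real.log ‖su (A x) 0 0‖ ∂μ) (CC η) ?_ ?_ ?_ ?_ ?_ δ hδ hlim
  · intro lam hl
    have hl := hl.le
    simp only [Complex.add_re]
    rw [← gE.contour_eq μ η hη hη2 lam hl, ← gP.contour_eq μ η hη hη2 lam hl,
      ← re_integral_t _ η hη (path_contC (gE.continuousOn μ) η hη hη2 lam hl),
      ← re_integral_t _ η hη (path_contC (gP.continuousOn μ) η hη hη2 lam hl)]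
    unfold SS
    rw [pow_zero, intervalIntegral.integral_congr (g := fun t : ℝ => (∫ x, Real.log ‖su (A x) 0 0‖ ∂μ)
       + (∫ x, Complex.log (Em (t:ℂ) (lam * qf η t) (φ x) 0 0) ∂μ).re
       + (∫ x, Complex.log (Pf A φ ((t:ℂ), lam * qf η t) x) ∂μ).re)]
    · have c1 := Complex.continuous_re.comp_continuousOn (path_contC (gE.continuousOn μ) η hη hη2 lam hl)
      have c2 := Complex.continuous_re.comp_continuousOn (path_contC (gP.continuousOn μ) η hη hη2 lam hl)
      rw [← hIcc] at c1 c2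
      have := intervalIntegral.integral_add (μ := volume) ((intervalIntegrable_const (c := ∫ x, Real.log ‖su (A x) 0 0‖ ∂μ)).add c1.intervalIntegrable) c2.intervalIntegrable
      simp only [Function.comp, Pi.add_apply] at this
      rw [this]
      have := intervalIntegral.integral_add (μ := volume) ((intervalIntegrable_const (c := ∫ x, Real.log ‖su (A x) 0 0‖ ∂μ))) c1.intervalIntegrable
      simp only [Function.comp] at this
      rw [this, intervalIntegral.integral_const, smul_eq_mul]
      ring
    · intro t ht
      rw [hIcc] at ht
      exact vv_one μ hA hφ hA1 hφ1 (real_path_mem η hη hη2 lam hl t ht)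
  · intro k lam hl
    have hl := hl.le
    rw [← (gQ k).contour_eq μ η hη hη2 lam hl,
      ← re_integral_t _ η hη (path_contC ((gQ k).continuousOn μ) η hη hη2 lam hl)]
    unfold SS
    rw [intervalIntegral.integral_congr (g := fun t : ℝ => 2 * vv μ T A φ (2^k) ((t:ℂ), lam * qf η t)
       + (∫ x, Complex.log (Qf T A φ (2^k) ((t:ℂ), lam * qf η t) x) ∂μ).re)]
    · have c1 := Complex.continuous_re.comp_continuousOn (path_contC ((gQ k).continuousOn μ) η hη hη2 lam hl)
      have c2 := path_cont (vv_contOn μ hT hA hφ hA1 hφ1 (2^k)) η hη hη2 lam hl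
      rw [← hIcc] at c1 c2
      have := intervalIntegral.integral_add (μ := volume) (c2.intervalIntegrable.const_mul 2) c1.intervalIntegrable
      simp only [Function.comp] at this
      rw [this, intervalIntegral.integral_const_mul]
    · intro t ht
      rw [hIcc] at ht
      have := vv_double μ hT hTm hA hφ hA1 hφ1 (2^k) (by positivity) (real_path_mem η hη hη2 lam hl t ht)
      simp only
      rw [← this, pow_succ, mul_two]
  · exact (gE.contour_diff μ η hη hη2).add (gP.contour_diff μ η hη hη2)
  · intro k; exact (gQ k).contour_diff μ η hη hη2
  · intro k lam hl
    apply GoodG.contour_bound μ η hη hη2 _ lam (by simpa using (mem_ball_zero_iff.1 hl).le)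
    intro p hp hp0 x
    obtain ⟨w, h1, h2, h3⟩ := Qf_form (T := T) hA1 hφ1 hp (2^k) (by positivity) x
    rw [h3]
    apply log_bound hp0 _ h1
    have := (Complex.abs_im_le_norm p.1).trans hp.2.2.1
    linarith [le_abs_self p.1.im]
end

def mkM (a b : ℂ) : Mat2 := !![a.re + b.re, b.im - a.im; a.im + b.im, a.re - b.re]

lemma al_mkM (a b : ℂ) : al (mkM a b) = a := by
  apply Complex.ext <;> simp [al, mkM] <;> ring
lemma be_mkM (a b : ℂ) : be (mkM a b) = b := by
  apply Complex.ext <;> simp [be, mkM] <;> ring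
lemma det_mkM (a b : ℂ) : (mkM a b).det = ‖a‖^2 - ‖b‖^2 := by
  rw [← Complex.normSq_eq_norm_sq, ← Complex.normSq_eq_norm_sq, Complex.normSq_apply, Complex.normSq_apply]
  simp [mkM, Matrix.det_fin_two]; ring
lemma mkM_al_be (g : Mat2) : mkM (al g) (be g) = g := by
  ext i j; fin_cases i <;> fin_cases j <;> simp [al, be, mkM] <;> ring

lemma al_sub (g h : Mat2) : al (g - h) = al g - al h := by
  apply Complex.ext <;> simp [al] <;> ring
lemma be_sub (g h : Mat2) : be (g - h) = be g - be h := by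
  apply Complex.ext <;> simp [be] <;> ring

/-- Euclidean vector as a complex number -/
def vc (v : E2) : ℂ := ⟨v 0, v 1⟩

lemma norm_vc (v : E2) : ‖vc v‖ = ‖v‖ := by
  rw [EuclideanSpace.norm_eq, Fin.sum_univ_two, Complex.norm_eq_sqrt_sq_add_sq]
  simp [vc]

lemma vc_apply (g : Mat2) (v : E2) : vc (Matrix.toEuclideanCLM (𝕜 := ℝ) g v) = al g * vc v + be g * star (vc v) := by
  have h : ∀ i, (Matrix.toEuclideanCLM (𝕜 := ℝ) g v) i = g i 0 * v 0 + g i 1 * v 1 := by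
    intro i
    have := congrFun (Matrix.ofLp_toEuclideanCLM (𝕜 := ℝ) g v) i
    rw [this, Matrix.mulVec, dotProduct, Fin.sum_univ_two]
  apply Complex.ext <;> simp [vc, al, be, h] <;> ring

lemma opNorm_nonneg (g : Mat2) : 0 ≤ opNorm g := norm_nonneg _
lemma opNorm_mul_le (g h : Mat2) : opNorm (g * h) ≤ opNorm g * opNorm h := by
  unfold opNorm; rw [map_mul]; exact norm_mul_le _ _
lemma opNorm_add_le (g h : Mat2) : opNorm (g + h) ≤ opNorm g + opNorm h := by
  unfold opNorm; rw [map_add]; exact norm_add_le _ _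
lemma opNorm_sub_le (g h : Mat2) : opNorm (g - h) ≤ opNorm g + opNorm h := by
  unfold opNorm; rw [map_sub]; exact norm_sub_le _ _
lemma opNorm_sub_comm (g h : Mat2) : opNorm (g - h) = opNorm (h - g) := by
  unfold opNorm; rw [map_sub, map_sub]; exact norm_sub_rev _ _

lemma opNorm_le (g : Mat2) : opNorm g ≤ ‖al g‖ + ‖be g‖ := by
  apply ContinuousLinearMap.opNorm_le_bound _ (by positivity)
  intro v
  rw [← norm_vc, vc_apply, ← norm_vc v]
  refine (norm_add_le _ _).trans ?_
  rw [norm_mul, norm_mul, norm_star]; linarith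

lemma al_le_opNorm (g : Mat2) : ‖al g‖ ≤ opNorm g := by
  have key : ∀ v : E2, ‖al g * vc v + be g * star (vc v)‖ ≤ opNorm g * ‖vc v‖ := by
    intro v
    rw [← vc_apply, norm_vc, norm_vc]; exact ContinuousLinearMap.le_opNorm _ _
  have h1 := key (!₂[1, 0])
  have h2 := key (!₂[0, 1])
  have e1 : vc (!₂[(1:ℝ), 0]) = 1 := by apply Complex.ext <;> simp [vc]
  have e2 : vc (!₂[(0:ℝ), 1]) = Complex.I := by apply Complex.ext <;> simp [vc]
  rw [e1] at h1; rw [e2] at h2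
  have e3 : al g * Complex.I + be g * star Complex.I = (al g - be g) * Complex.I := by
    simp; ring
  rw [e3, norm_mul, Complex.norm_I, mul_one, mul_one] at h2
  simp only [star_one, mul_one, norm_one] at h1
  have h3 := parallelogram_law_with_norm ℝ (al g) (be g)
  have h4 := opNorm_nonneg g
  by_contra hcon
  push Not at hcon
  have := norm_nonneg (al g + be g); have := norm_nonneg (al g - be g)
  nlinarith [norm_nonneg (be g), norm_nonneg (al g)]

lemma be_le_al (g : Mat2) (hg : g.det = 1) : ‖be g‖ ≤ ‖al g‖ := by
  have := al_be g hg
  nlinarith [norm_nonneg (be g), norm_nonneg (al g)]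

lemma one_le_al (g : Mat2) (hg : g.det = 1) : 1 ≤ ‖al g‖ := by
  have := al_be g hg
  nlinarith [norm_nonneg (be g), norm_nonneg (al g)]

lemma one_le_opNorm (g : Mat2) (hg : g.det = 1) : 1 ≤ opNorm g := (one_le_al g hg).trans (al_le_opNorm g)

/-- the perturbing matrix -/
def Pert (t s : ℝ) (φ : ℂ) : Mat2 :=
  mkM (Complex.exp (-(Complex.I * t)) * Complex.cosh s) (Complex.exp (-(Complex.I * t)) * (φ * Complex.sinh s))

lemma su_Pert (t s : ℝ) (φ : ℂ) : su (Pert t s φ) = Em t s φ := by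
  have h1 : (starRingEnd ℂ) (Complex.cosh s) = Complex.cosh s := by rw [← Complex.cosh_conj, Complex.conj_ofReal]
  have h2 : (starRingEnd ℂ) (Complex.sinh s) = Complex.sinh s := by rw [← Complex.sinh_conj, Complex.conj_ofReal]
  have h3 : (starRingEnd ℂ) (Complex.exp (-(Complex.I * t))) = Complex.exp (Complex.I * t) := by
    rw [← Complex.exp_conj]; simp
  ext i j
  fin_cases i <;> fin_cases j <;> simp [su, Em, Pert, al_mkM, be_mkM, h1, h2, h3]

lemma norm_expI (t : ℝ) : ‖Complex.exp (-(Complex.I * t))‖ = 1 := by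
  rw [Complex.norm_exp]; simp

lemma Pert_det (t s : ℝ) (φ : ℂ) (hφ : ‖φ‖ = 1) : (Pert t s φ).det = 1 := by
  rw [Pert, det_mkM, norm_mul, norm_mul, norm_mul, norm_expI, hφ, ← Complex.ofReal_cosh, ← Complex.ofReal_sinh,
    Complex.norm_real, Complex.norm_real, Real.norm_eq_abs, Real.norm_eq_abs]
  have := Real.cosh_sq s
  simp only [one_mul, sq_abs]; linarith

lemma norm_sinh_le (s : ℝ) (hs : |s| ≤ 1) : ‖Complex.sinh s‖ ≤ 2 * |s| := by
  have e2 := Complex.norm_exp_sub_one_le (x := (s:ℂ)) (by simpa using hs)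
  have e3 := Complex.norm_exp_sub_one_le (x := -(s:ℂ)) (by simpa using hs)
  rw [norm_neg] at e3
  rw [Complex.norm_real, Real.norm_eq_abs] at e2 e3
  have : Complex.sinh s = (1/2) * (Complex.exp s - 1) - (1/2) * (Complex.exp (-s) - 1) := by
    rw [Complex.sinh]; ring
  rw [this]
  refine (norm_sub_le _ _).trans ?_
  rw [norm_mul, norm_mul]; norm_num; linarith

lemma norm_cosh_le (s : ℝ) (hs : |s| ≤ 1) : ‖Complex.cosh s - 1‖ ≤ 2 * |s| := by
  have e2 := Complex.norm_exp_sub_one_le (x := (s:ℂ)) (by simpa using hs)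
  have e3 := Complex.norm_exp_sub_one_le (x := -(s:ℂ)) (by simpa using hs)
  rw [norm_neg] at e3
  rw [Complex.norm_real, Real.norm_eq_abs] at e2 e3
  have : Complex.cosh s - 1 = (1/2) * (Complex.exp s - 1) + (1/2) * (Complex.exp (-s) - 1) := by
    rw [Complex.cosh]; ring
  rw [this]
  refine (norm_add_le _ _).trans ?_
  rw [norm_mul, norm_mul]; norm_num; linarith

lemma al_one : al 1 = 1 := by apply Complex.ext <;> simp [al]
lemma be_one : be 1 = 0 := by apply Complex.ext <;> simp [be]

lemma Pert_sub_one (t s : ℝ) (φ : ℂ) (hφ : ‖φ‖ = 1) (ht : |t| ≤ 1) (hs : |s| ≤ 1) :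
    opNorm (Pert t s φ - 1) ≤ 2 * |t| + 4 * |s| := by
  refine (opNorm_le _).trans ?_
  rw [al_sub, be_sub, al_one, be_one, Pert, al_mkM, be_mkM, sub_zero, norm_mul, norm_mul, norm_expI, hφ]
  have e1 := Complex.norm_exp_sub_one_le (x := -(Complex.I * t)) (by simpa using ht)
  simp only [norm_neg, norm_mul, Complex.norm_I, one_mul, Complex.norm_real, Real.norm_eq_abs] at e1
  have e2 := norm_sinh_le s hs
  have e3 := norm_cosh_le s hs
  have e4 : Complex.exp (-(Complex.I * t)) * Complex.cosh s - 1 = Complex.exp (-(Complex.I * t)) * (Complex.cosh s - 1) + (Complex.exp (-(Complex.I * t)) - 1) := by ring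
  rw [e4]
  have e5 := norm_add_le (Complex.exp (-(Complex.I * t)) * (Complex.cosh s - 1)) (Complex.exp (-(Complex.I * t)) - 1)
  rw [norm_mul, norm_expI] at e5
  linarith

lemma Pert_sub (t s : ℝ) (φ ψ : ℂ) (hφ : ‖φ‖ = 1) (hψ : ‖ψ‖ = 1) (hs : |s| ≤ 1) :
    opNorm (Pert t s φ - Pert t s ψ) ≤ 4 * |s| := by
  refine (opNorm_le _).trans ?_
  rw [al_sub, be_sub, Pert, Pert, al_mkM, be_mkM, al_mkM, be_mkM, sub_self, norm_zero, zero_add, ← mul_sub, ← sub_mul,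
    norm_mul, norm_mul, norm_expI]
  have := norm_sub_le φ ψ
  have e2 := norm_sinh_le s hs
  nlinarith [norm_nonneg (φ - ψ), abs_nonneg s]

lemma mkM_cont {X : Type*} [TopologicalSpace X] {f g : X → ℂ} (hf : Continuous f) (hg : Continuous g) :
    Continuous fun x => mkM (f x) (g x) := by
  apply continuous_matrix
  intro i j
  fin_cases i <;> fin_cases j <;> simp [mkM] <;> fun_prop

lemma opNorm_cont : Continuous opNorm := by
  unfold opNorm
  refine continuous_norm.comp ?_
  exact LinearMap.continuous_of_finiteDimensional (Matrix.toEuclideanCLM (n := Fin 2) (𝕜 := ℝ)).toAlgEquiv.toLinearMap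

section dyn
variable {κ : ℕ}

lemma shift_cont : Continuous (shift : Sig κ → Sig κ) := by
  unfold shift; fun_prop

lemma sl2_cont {X : Type*} [TopologicalSpace X] {A : X → SL2} (hA : Continuous A) : Continuous fun x => (A x : Mat2) :=
  continuous_subtype_val.comp hA

lemma sl2_cont_mk {X : Type*} [TopologicalSpace X] {A : X → SL2} (hA : Continuous fun x => (A x : Mat2)) : Continuous A :=
  continuous_induced_rng.2 hA

lemma det_sl (g : SL2) : (g : Mat2).det = 1 := g.2

/-- perturbing matrix as an element of `SL2` -/
def PertS (t s : ℝ) (φ : ℂ) (hφ : ‖φ‖ = 1) : SL2 := ⟨Pert t s φ, Pert_det t s _ hφ⟩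

/-- perturbed cocycle -/
def BB (A : Sig κ → SL2) (φ : Sig κ → ℂ) (hφ : ∀ x, ‖φ x‖ = 1) (t s : ℝ) (x : Sig κ) : SL2 :=
  PertS t s (φ x) (hφ x) * A x

lemma coe_BB (A : Sig κ → SL2) (φ : Sig κ → ℂ) (hφ : ∀ x, ‖φ x‖ = 1) (t s : ℝ) (x : Sig κ) :
    (BB A φ hφ t s x : Mat2) = Pert t s (φ x) * (A x : Mat2) := by
  rw [BB, Matrix.SpecialLinearGroup.coe_mul]; rfl

lemma su_coc (A : Sig κ → SL2) (φ : Sig κ → ℂ) (hφ : ∀ x, ‖φ x‖ = 1) (t s : ℝ) (n : ℕ) (x : Sig κ) :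
    su (cocycleN (BB A φ hφ t s) n x : SL2) = CM shift (fun x => (A x : Mat2)) φ n ((t:ℂ), (s:ℂ)) x := by
  induction n generalizing x with
  | zero => simp [cocycleN, CM, su_one]
  | succ n ih =>
    rw [cocycleN, CM, ← ih, Matrix.SpecialLinearGroup.coe_mul, su_mul, coe_BB, su_mul, su_Pert]

lemma al_coc (A : Sig κ → SL2) (φ : Sig κ → ℂ) (hφ : ∀ x, ‖φ x‖ = 1) (t s : ℝ) (n : ℕ) (x : Sig κ) :
    ff shift (fun x => (A x : Mat2)) φ n ((t:ℂ), (s:ℂ)) x = al (cocycleN (BB A φ hφ t s) n x : SL2) := by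
  rw [ff, ← su_coc A φ hφ]; simp [su]

lemma BB_cont (A : Sig κ → SL2) (hA : Continuous A) (φ : Sig κ → ℂ) (hφ : ∀ x, ‖φ x‖ = 1) (hc : Continuous φ) (t s : ℝ) :
    Continuous (BB A φ hφ t s) := by
  apply sl2_cont_mk
  simp only [coe_BB]
  refine Continuous.matrix_mul ?_ (sl2_cont hA)
  unfold Pert
  exact mkM_cont (by fun_prop) (by fun_prop)

lemma coc_cont {B : Sig κ → SL2} (hB : Continuous B) (n : ℕ) : Continuous fun x => (cocycleN B n x : Mat2) := by
  induction n with
  | zero => simp only [cocycleN]; exact continuous_const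
  | succ n ih =>
    simp only [cocycleN, Matrix.SpecialLinearGroup.coe_mul]
    exact (ih.comp shift_cont).matrix_mul (sl2_cont hB)

lemma coc_add (B : Sig κ → SL2) (n m : ℕ) (x : Sig κ) :
    cocycleN B (n + m) x = cocycleN B n (shift^[m] x) * cocycleN B m x := by
  induction m generalizing x with
  | zero => simp [cocycleN]
  | succ m ih => rw [← add_assoc, cocycleN, ih, cocycleN, Function.iterate_succ_apply, mul_assoc]

/-- the shift preserves the Bernoulli measure -/
lemma shift_mp {p : Fin κ → ℝ} {μ : Measure (Sig κ)} (hμ : IsBernoulli p μ) : MeasurePreserving (shift : Sig κ → Sig κ) μ μ := by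
  have := hμ.1
  refine ⟨shift_cont.measurable, ?_⟩
  have : IsProbabilityMeasure (μ.map shift) := Measure.isProbabilityMeasure_map shift_cont.measurable.aemeasurable
  let C : Set (Set (Sig κ)) := insert ∅ {S | ∃ (s : Finset ℤ) (a : ℤ → Fin κ), S = {x | ∀ n ∈ s, x n = a n}}
  have hgen : (MeasurableSpace.pi : MeasurableSpace (Sig κ)) = MeasurableSpace.generateFrom C := by
    apply le_antisymm
    · apply iSup_le
      intro n
      rw [← measurable_iff_comap_le]
      refine @measurable_to_countable' (Fin κ) (Sig κ) _ _ (MeasurableSpace.generateFrom C) _ ?_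
      intro i
      apply MeasurableSpace.measurableSet_generateFrom
      right
      refine ⟨{n}, fun _ => i, ?_⟩
      ext x; simp
    · apply MeasurableSpace.generateFrom_le
      rintro S (rfl | ⟨s, a, rfl⟩)
      · exact MeasurableSet.empty
      · have : {x : Sig κ | ∀ n ∈ s, x n = a n} = ⋂ n ∈ s, (fun x : Sig κ => x n) ⁻¹' {a n} := by ext; simp
        rw [this]
        exact Finset.measurableSet_biInter _ (fun n _ => measurable_pi_apply n (measurableSet_singleton _))
  have hpi : IsPiSystem C := by
    rintro S hS U hU hne
    rcases hS with rfl | ⟨s, a, rfl⟩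
    · simp at hne
    rcases hU with rfl | ⟨u, b, rfl⟩
    · simp at hne
    right
    obtain ⟨y, hy1, hy2⟩ := hne
    refine ⟨s ∪ u, y, ?_⟩
    ext x
    simp only [Set.mem_inter_iff, Set.mem_setOf_eq, Finset.mem_union] at *
    constructor
    · rintro ⟨h1, h2⟩ n (hn | hn)
      · rw [h1 n hn, hy1 n hn]
      · rw [h2 n hn, hy2 n hn]
    · intro h
      exact ⟨fun n hn => by rw [h n (Or.inl hn), hy1 n hn], fun n hn => by rw [h n (Or.inr hn), hy2 n hn]⟩
  refine ext_of_generate_finite C hgen hpi ?_ (by simp)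
  rintro S (rfl | ⟨s, a, rfl⟩)
  · simp
  have hm : MeasurableSet {x : Sig κ | ∀ n ∈ s, x n = a n} := by
    have : {x : Sig κ | ∀ n ∈ s, x n = a n} = ⋂ n ∈ s, (fun x : Sig κ => x n) ⁻¹' {a n} := by ext; simp
    rw [this]
    exact Finset.measurableSet_biInter _ (fun n _ => measurable_pi_apply n (measurableSet_singleton _))
  rw [Measure.map_apply shift_cont.measurable hm]
  have : shift ⁻¹' {x : Sig κ | ∀ n ∈ s, x n = a n} = {x | ∀ n ∈ s.map (addRightEmbedding 1), x n = a (n - 1)} := by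
    ext x; simp [shift]
  rw [this, hμ.2 s a, hμ.2 (s.map (addRightEmbedding 1)) (fun n => a (n - 1)), Finset.prod_map]
  simp

variable {p : Fin κ → ℝ} {μ : Measure (Sig κ)}

def aa (μ : Measure (Sig κ)) (B : Sig κ → SL2) (n : ℕ) : ℝ := ∫ x, Real.log (opNorm (cocycleN B n x : SL2)) ∂μ

lemma logop_cont {B : Sig κ → SL2} (hB : Continuous B) (n : ℕ) : Continuous fun x => Real.log (opNorm (cocycleN B n x : SL2)) := by
  refine (opNorm_cont.comp (coc_cont hB n)).log (fun x => ?_)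
  have := one_le_opNorm _ (det_sl (cocycleN B n x))
  simp only [Function.comp]; positivity

lemma aa_nonneg (B : Sig κ → SL2) (n : ℕ) : 0 ≤ aa μ B n :=
  integral_nonneg fun x => Real.log_nonneg (one_le_opNorm _ (det_sl _))

lemma aa_sub (hμ : IsBernoulli p μ) {B : Sig κ → SL2} (hB : Continuous B) : Subadditive (aa μ B) := by
  intro m n
  have := hμ.1
  have hmp := (shift_mp hμ).iterate n
  have h2 : ∫ x, Real.log (opNorm (cocycleN B m (shift^[n] x) : SL2)) ∂μ = aa μ B m := by
    have := integral_map (μ := μ) (φ := shift^[n]) hmp.measurable.aemeasurable (f := fun x => Real.log (opNorm (cocycleN B m x : SL2)))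
      (by rw [hmp.map_eq]; exact (logop_cont hB m).aestronglyMeasurable)
    rw [hmp.map_eq] at this
    exact this.symm
  rw [← h2]
  have i1 := integrable_of_cont μ ((logop_cont hB m).comp (shift_cont.iterate n))
  have i2 := integrable_of_cont μ (logop_cont hB n)
  have i3 := integrable_of_cont μ (logop_cont hB (m+n))
  unfold aa
  have e := integral_add i1 i2
  simp only [Function.comp] at e
  rw [← e]
  refine integral_mono i3 (i1.add i2) ?_
  intro x
  simp only [Pi.add_apply, Function.comp]
  have h1 := one_le_opNorm _ (det_sl (cocycleN B (m+n) x))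
  have h3 := one_le_opNorm _ (det_sl (cocycleN B n x))
  have h4 := one_le_opNorm _ (det_sl (cocycleN B m (shift^[n] x)))
  rw [← Real.log_mul (by positivity) (by positivity)]
  apply Real.log_le_log (by positivity)
  rw [coc_add, Matrix.SpecialLinearGroup.coe_mul]
  exact opNorm_mul_le _ _

lemma aa_tendsto (hμ : IsBernoulli p μ) {B : Sig κ → SL2} (hB : Continuous B) (hL : lyap μ B ≤ 0) :
    Filter.Tendsto (fun n => aa μ B n / n) Filter.atTop (nhds 0) := by
  have hs := aa_sub hμ hB
  have hnn : ∀ n : ℕ, 0 ≤ aa μ B n / n := fun n => div_nonneg (aa_nonneg B n) (by positivity)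
  have hbdd : BddBelow (Set.range fun n => aa μ B n / n) := ⟨0, by rintro _ ⟨n, rfl⟩; exact hnn n⟩
  have ht := hs.tendsto_lim hbdd
  have h0 : 0 ≤ hs.lim := ge_of_tendsto' ht hnn
  have h1 : hs.lim ≤ 0 := by
    refine le_of_forall_pos_le_add (fun ε hε => ?_)
    have : Nonempty {m : ℕ // 0 < m} := ⟨⟨1, one_pos⟩⟩
    obtain ⟨n, hn⟩ := exists_lt_of_ciInf_lt (lt_of_le_of_lt hL hε)
    have := hs.lim_le_div hbdd (n := n) n.2.ne'
    have e : aa μ B n / (n:ℕ) = ((n:ℕ):ℝ)⁻¹ * aa μ B n := by rw [div_eq_inv_mul]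
    rw [e] at this
    rw [zero_add]
    exact this.trans hn.le
  rwa [le_antisymm h1 h0] at ht

lemma real_path_eq (η lam t : ℝ) : ((lam:ℂ) * qf η t) = ((lam * (η^2 - t^2) : ℝ) : ℂ) := by
  simp [qf]

lemma vv_nonneg (A : Sig κ → SL2) (φ : Sig κ → ℂ) (hφ : ∀ x, ‖φ x‖ = 1) (n : ℕ) (t s : ℝ) :
    0 ≤ vv μ shift (fun x => (A x : Mat2)) φ n ((t:ℂ), (s:ℂ)) := by
  refine integral_nonneg fun x => ?_
  simp only [Pi.zero_apply]
  rw [al_coc A φ hφ]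
  exact Real.log_nonneg (one_le_al _ (det_sl _))

lemma vv_le (hμ : IsBernoulli p μ) (A : Sig κ → SL2) (hA : Continuous A) (φ : Sig κ → ℂ) (hφ : ∀ x, ‖φ x‖ = 1) (hc : Continuous φ)
    (n : ℕ) (t s : ℝ) (hD : ((t:ℂ), (s:ℂ)) ∈ Dom) :
    vv μ shift (fun x => (A x : Mat2)) φ n ((t:ℂ), (s:ℂ)) ≤ aa μ (BB A φ hφ t s) n := by
  have := hμ.1
  refine integral_mono (integrable_of_cont μ (logff_cont shift_cont (sl2_cont hA) hc (fun x => det_sl (A x)) hφ n hD))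
    (integrable_of_cont μ (logop_cont (BB_cont A hA φ hφ hc t s) n)) ?_
  intro x
  simp only
  rw [al_coc A φ hφ]
  have := one_le_al _ (det_sl (cocycleN (BB A φ hφ t s) n x))
  exact Real.log_le_log (by positivity) (al_le_opNorm _)

lemma SS_tendsto (hμ : IsBernoulli p μ) (A : Sig κ → SL2) (hA : Continuous A) (φ : Sig κ → ℂ) (hφ : ∀ x, ‖φ x‖ = 1) (hc : Continuous φ)
    (η : ℝ) (hη : 0 < η) (hη2 : η ≤ 1/100) (lam : ℝ) (hl : |lam| ≤ 2) (M : ℝ) (hM : ∀ x, opNorm (A x) ≤ M)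
    (hL : ∀ t ∈ Set.Icc (-η) η, lyap μ (BB A φ hφ t (lam * (η^2 - t^2))) ≤ 0) :
    Filter.Tendsto (fun k => SS μ shift (fun x => (A x : Mat2)) φ η k lam / 2^k) Filter.atTop (nhds 0) := by
  have := hμ.1
  have hne : Nonempty (Sig κ) := by
    by_contra h
    rw [not_nonempty_iff] at h
    have := measure_univ (μ := μ)
    rw [Set.univ_eq_empty_iff.2 h] at this
    simp at this
  have hA2 := sl2_cont hA
  have hA1 := fun x => det_sl (A x)
  have hDom : ∀ t ∈ Set.Icc (-η) η, ((t:ℂ), ((lam * (η^2 - t^2) : ℝ) : ℂ)) ∈ Dom := by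
    intro t ht
    have := real_path_mem η hη hη2 lam hl t ht
    rwa [real_path_eq] at this
  have hM1 : 1 ≤ M := (one_le_opNorm _ (det_sl (A hne.some))).trans (hM _)
  have hIoc : ∀ t ∈ Set.uIoc (-η) η, t ∈ Set.Icc (-η) η := by
    intro t ht; rw [Set.uIoc_of_le (by linarith)] at ht; exact Set.Ioc_subset_Icc_self ht
  have hup : ∀ (k : ℕ), ∀ t ∈ Set.Icc (-η) η,
      vv μ shift (fun x => (A x : Mat2)) φ (2^k) ((t:ℂ), lam * qf η t) / 2^k ≤ Real.log (2 * M) := by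
    intro k t ht
    rw [div_le_iff₀ (by positivity), real_path_eq]
    refine (vv_le hμ A hA φ hφ hc (2^k) t _ (hDom t ht)).trans ?_
    set B := BB A φ hφ t (lam * (η^2 - t^2)) with hB
    have hBc : Continuous B := BB_cont A hA φ hφ hc _ _
    have hpos : ∀ x, 0 < opNorm (A x) := fun x => lt_of_lt_of_le one_pos (one_le_opNorm _ (det_sl (A x)))
    have h1 : aa μ B 1 ≤ Real.log (2 * M) := by
      have : ∀ x, Real.log (opNorm (cocycleN B 1 x : SL2)) ≤ Real.log (2 * M) := by
        intro x
        have h3 := one_le_opNorm _ (det_sl (cocycleN B 1 x))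
        apply Real.log_le_log (by positivity)
        have e : cocycleN B 1 x = B x := by simp [cocycleN]
        rw [e, hB, coe_BB]
        refine (opNorm_mul_le _ _).trans ?_
        have hd := hDom t ht
        obtain ⟨_, _, d3, d4⟩ := hd
        rw [Complex.norm_real, Real.norm_eq_abs] at d3 d4
        have h4 := Pert_sub_one t (lam * (η^2 - t^2)) (φ x) (hφ x) (by linarith) (by linarith)
        have h5 : opNorm (Pert t (lam * (η^2 - t^2)) (φ x)) ≤ 2 := by
          have e1 : Pert t (lam * (η^2 - t^2)) (φ x) = (Pert t (lam * (η^2 - t^2)) (φ x) - 1) + 1 := by simp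
          rw [e1]
          refine (opNorm_add_le _ _).trans ?_
          have : opNorm (1 : Mat2) ≤ 1 := by
            refine (opNorm_le _).trans ?_
            rw [al_one, be_one]; simp
          linarith
        exact mul_le_mul h5 (hM x) (opNorm_nonneg _) (by norm_num)
      have := integral_mono (integrable_of_cont μ (logop_cont hBc 1)) (integrable_const (Real.log (2 * M))) this
      have e : ∫ _ : Sig κ, Real.log (2 * M) ∂μ = Real.log (2 * M) := by simp
      rw [e] at this
      exact this
    have hs := aa_sub hμ hBc
    have h2 : ∀ n : ℕ, aa μ B (n+1) ≤ (n+1) * Real.log (2*M) := by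
      intro n
      induction n with
      | zero => simpa using h1
      | succ n ih =>
        have := hs (n+1) 1
        push_cast; linarith
    have h3 := h2 (2^k - 1)
    have e : 2^k - 1 + 1 = 2^k := Nat.sub_add_cancel Nat.one_le_two_pow
    rw [e] at h3
    have e2 : ((2^k - 1 : ℕ) : ℝ) + 1 = 2^k := by exact_mod_cast e
    rw [e2] at h3
    linarith
  have key := intervalIntegral.tendsto_integral_filter_of_dominated_convergence (μ := volume) (a := -η) (b := η)
    (l := Filter.atTop) (F := fun (k : ℕ) (t : ℝ) => vv μ shift (fun x => (A x : Mat2)) φ (2^k) ((t:ℂ), lam * qf η t) / 2^k)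
    (f := fun _ => 0) (fun _ => Real.log (2 * M)) ?_ ?_ ?_ ?_
  · simp only [intervalIntegral.integral_div, intervalIntegral.integral_zero] at key
    exact key
  · refine Filter.Eventually.of_forall (fun k => ?_)
    have c := (path_cont (vv_contOn μ shift_cont hA2 hc hA1 hφ (2^k)) η hη hη2 lam hl).div_const (2^k)
    refine (c.mono ?_).aestronglyMeasurable measurableSet_uIoc
    exact hIoc
  · refine Filter.Eventually.of_forall (fun k => Filter.Eventually.of_forall (fun t ht => ?_))
    rw [Real.norm_eq_abs, abs_of_nonneg]
    · exact hup k t (hIoc t ht)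
    · rw [real_path_eq]; exact div_nonneg (vv_nonneg A φ hφ _ _ _) (by positivity)
  · exact intervalIntegrable_const
  · refine Filter.Eventually.of_forall (fun t ht => ?_)
    have ht := hIoc t ht
    have h1 := aa_tendsto hμ (BB_cont A hA φ hφ hc t (lam * (η^2 - t^2))) (hL t ht)
    have h2 := h1.comp (tendsto_pow_atTop_atTop_of_one_lt (r := (2:ℕ)) (by norm_num))
    refine squeeze_zero (fun k => ?_) (fun k => ?_) h2
    · rw [real_path_eq]; exact div_nonneg (vv_nonneg A φ hφ _ _ _) (by positivity)
    · simp only [Function.comp, Nat.cast_pow, Nat.cast_ofNat]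
      rw [real_path_eq]
      gcongr
      exact vv_le hμ A hA φ hφ hc (2^k) t _ (hDom t ht)
end dyn

section windows
variable {κ : ℕ}

/-- the four phases -/
def ph (j : Fin 4) : ℂ := Complex.I ^ (j : ℕ)

lemma norm_ph (j : Fin 4) : ‖ph j‖ = 1 := by simp [ph]

abbrev Win (κ N : ℕ) : Type := Finset.Icc (-(N:ℤ)) N → Fin κ

def win (N : ℕ) (x : Sig κ) : Win κ N := fun i => x i

def phi (N : ℕ) (a : Win κ N → Fin 4) (x : Sig κ) : ℂ := ph (a (win N x))

lemma norm_phi (N : ℕ) (a : Win κ N → Fin 4) (x : Sig κ) : ‖phi N a x‖ = 1 := norm_ph _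

lemma phi_cont (N : ℕ) (a : Win κ N → Fin 4) : Continuous (phi N a) := by
  have h1 : Continuous (win N : Sig κ → Win κ N) := by unfold win; fun_prop
  exact (continuous_of_discreteTopology (f := fun w => ph (a w))).comp h1

lemma dSig_nonneg {ζ : ℝ} (hζ : 1 < ζ) (x y : Sig κ) : 0 ≤ dSig ζ x y := by
  unfold dSig; split_ifs
  · exact le_rfl
  · positivity

lemma dSig_ge {ζ : ℝ} (hζ : 1 < ζ) (N : ℕ) (x y : Sig κ) (h : win N x ≠ win N y) : ζ ^ (-(N:ℤ)) ≤ dSig ζ x y := by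
  have hne : x ≠ y := fun e => h (by rw [e])
  rw [dSig, if_neg hne]
  apply zpow_le_zpow_right₀ hζ.le
  have : firstDiff x y ≤ N := by
    obtain ⟨⟨i, hi⟩, hd⟩ := Function.ne_iff.1 h
    rw [Finset.mem_Icc] at hi
    simp only [win] at hd
    have : i.natAbs ∈ {m : ℕ | x (m : ℤ) ≠ y (m : ℤ) ∨ x (-(m : ℤ)) ≠ y (-(m : ℤ))} := by
      rcases le_total 0 i with h0 | h0
      · left; rwa [Int.natAbs_of_nonneg h0]
      · right; rwa [Int.ofNat_natAbs_of_nonpos h0, neg_neg]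
    exact (Nat.sInf_le this).trans (by omega)
  omega

lemma close_lemma {ζ γ : ℝ} (hζ : 1 < ζ) (hγ : 0 ≤ γ) (A : Sig κ → SL2) (M H : ℝ) (hM0 : 0 ≤ M) (hH : 0 ≤ H)
    (hM : ∀ x, opNorm (A x) ≤ M)
    (hAH : ∀ x y : Sig κ, x ≠ y → opNorm ((A x : Mat2) - (A y : Mat2)) ≤ H * (dSig ζ x y) ^ γ)
    (N : ℕ) (a : Win κ N → Fin 4) (t s e : ℝ) (ht : |t| ≤ 1) (hs : |s| ≤ 1)
    (he : 2 * |t| + 4 * |s| ≤ e) :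
    HolderCocycle ζ γ (BB A (phi N a) (norm_phi N a) t s) ∧
    ∀ ε, e * (M + H) + 4 * |s| * M / (ζ ^ (-(N:ℤ))) ^ γ < ε → CgammaClose ζ γ A (BB A (phi N a) (norm_phi N a) t s) ε := by
  set B := BB A (phi N a) (norm_phi N a) t s with hB
  set z := (ζ ^ (-(N:ℤ))) ^ γ with hz
  have hzpos : 0 < z := by positivity
  set C2 := e * H + 4 * |s| * M / z with hC2
  have hdiff : ∀ x, (A x : Mat2) - (B x : Mat2) = -((Pert t s (phi N a x) - 1) * (A x : Mat2)) := by
    intro x; rw [hB, coe_BB, sub_mul, one_mul]; abel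
  have hE : ∀ x, opNorm (Pert t s (phi N a x) - 1) ≤ e := fun x =>
    (Pert_sub_one t s _ (norm_phi N a x) ht hs).trans he
  have hneg : ∀ g : Mat2, opNorm (-g) = opNorm g := by
    intro g; unfold opNorm; rw [map_neg, norm_neg]
  have he0 : 0 ≤ e := le_trans (by positivity) he
  have hold : ∀ x y : Sig κ, x ≠ y →
      opNorm (((A x : Mat2) - (B x : Mat2)) - ((A y : Mat2) - (B y : Mat2))) ≤ C2 * (dSig ζ x y) ^ γ := by
    intro x y hxy
    have hd0 : 0 ≤ (dSig ζ x y) ^ γ := Real.rpow_nonneg (dSig_nonneg hζ x y) _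
    have e1 : ((A x : Mat2) - (B x : Mat2)) - ((A y : Mat2) - (B y : Mat2)) =
        -((Pert t s (phi N a x) - 1) * ((A x : Mat2) - (A y : Mat2)) + (Pert t s (phi N a x) - Pert t s (phi N a y)) * (A y : Mat2)) := by
      rw [hdiff, hdiff]; noncomm_ring
    rw [e1, hneg]
    have h1 : opNorm ((Pert t s (phi N a x) - 1) * ((A x : Mat2) - (A y : Mat2))) ≤ e * (H * (dSig ζ x y) ^ γ) :=
      (opNorm_mul_le _ _).trans (mul_le_mul (hE x) (hAH x y hxy) (opNorm_nonneg _) he0)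
    have h2 : opNorm ((Pert t s (phi N a x) - Pert t s (phi N a y)) * (A y : Mat2)) ≤ 4 * |s| * M / z * (dSig ζ x y) ^ γ := by
      by_cases hw : win N x = win N y
      · have : phi N a x = phi N a y := by unfold phi; rw [hw]
        rw [this, sub_self, zero_mul]
        have : opNorm (0 : Mat2) = 0 := by unfold opNorm; simp
        rw [this]; positivity
      · refine (opNorm_mul_le _ _).trans ((mul_le_mul (Pert_sub t s _ _ (norm_phi N a x) (norm_phi N a y) hs) (hM y) (opNorm_nonneg _) (by positivity)).trans ?_)
        have h3 : z ≤ (dSig ζ x y) ^ γ := Real.rpow_le_rpow (by positivity) (dSig_ge hζ N x y hw) hγ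
        rw [div_mul_eq_mul_div, le_div_iff₀ hzpos]
        gcongr
    refine (opNorm_add_le _ _).trans ?_
    rw [hC2]; linarith
  refine ⟨⟨H + C2, ?_⟩, ?_⟩
  · intro x y hxy
    have e1 : (B x : Mat2) - (B y : Mat2) = ((A x : Mat2) - (A y : Mat2)) - (((A x : Mat2) - (B x : Mat2)) - ((A y : Mat2) - (B y : Mat2))) := by abel
    rw [e1]
    refine (opNorm_sub_le _ _).trans ?_
    have := hold x y hxy; have := hAH x y hxy
    linarith
  · intro ε hε
    refine ⟨e * M, C2, by rw [hC2]; linarith, ?_, hold⟩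
    intro x
    rw [hdiff, hneg]
    exact (opNorm_mul_le _ _).trans (mul_le_mul (hE x) (hM x) (opNorm_nonneg _) he0)

/-- Under the negation of the conclusion, all the integrals are uniformly bounded. -/
theorem bound_of_neg {p : Fin κ → ℝ} {μ : Measure (Sig κ)} (hμ : IsBernoulli p μ)
    {ζ γ : ℝ} (hζ : 1 < ζ) (hγ : 0 ≤ γ) (A : Sig κ → SL2) (hA : Continuous A) (hAH : HolderCocycle ζ γ A)
    (ε : ℝ) (hε : 0 < ε)
    (hneg : ¬ ∃ B : Sig κ → SL2, Continuous B ∧ HolderCocycle ζ γ B ∧ 0 < lyap μ B ∧ CgammaClose ζ γ A B ε) :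
    ∃ η : ℝ, 0 < η ∧ η ≤ 1/100 ∧ ∀ (N : ℕ) (a : Win κ N → Fin 4) (k : ℕ),
      SS μ shift (fun x => (A x : Mat2)) (phi N a) η k 1 ≤ CC η := by
  have := hμ.1
  obtain ⟨H0, hH0⟩ := hAH
  obtain ⟨M, hM⟩ := isCompact_univ.exists_bound_of_continuousOn (opNorm_cont.comp (sl2_cont hA)).continuousOn
  have hM : ∀ x, opNorm (A x) ≤ M := fun x => (le_abs_self _).trans (hM x trivial)
  have hM' : ∀ x, opNorm (A x) ≤ |M| := fun x => (hM x).trans (le_abs_self _)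
  have hH : ∀ x y : Sig κ, x ≠ y → opNorm ((A x : Mat2) - (A y : Mat2)) ≤ |H0| * (dSig ζ x y) ^ γ := fun x y hxy =>
    (hH0 x y hxy).trans (mul_le_mul_of_nonneg_right (le_abs_self _) (Real.rpow_nonneg (dSig_nonneg hζ x y) _))
  set K := |M| + |H0| with hK
  have hK0 : 0 ≤ K := by positivity
  obtain ⟨η, hη, hη2, hη3⟩ : ∃ η : ℝ, 0 < η ∧ η ≤ 1/100 ∧ 6 * η * K ≤ ε / 4 := by
    refine ⟨min (1/100) (ε / (24 * (K + 1))), by positivity, min_le_left _ _, ?_⟩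
    have h1 := min_le_right (1/100) (ε / (24 * (K + 1)))
    have : 6 * (ε / (24 * (K + 1))) * K ≤ ε / 4 := by
      rw [mul_div_assoc', div_mul_eq_mul_div, div_le_iff₀ (by positivity)]
      nlinarith
    refine le_trans ?_ this
    gcongr
  refine ⟨η, hη, hη2, ?_⟩
  intro N a
  set z := (ζ ^ (-(N:ℤ))) ^ γ with hz
  have hzpos : 0 < z := by positivity
  obtain ⟨δ, hδ, hδ1, hδ2⟩ : ∃ δ : ℝ, 0 < δ ∧ δ ≤ 1 ∧ 4 * δ * |M| / z ≤ ε / 4 := by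
    refine ⟨min 1 (ε * z / (16 * (|M| + 1))), by positivity, min_le_left _ _, ?_⟩
    have h1 := min_le_right 1 (ε * z / (16 * (|M| + 1)))
    have : 4 * (ε * z / (16 * (|M| + 1))) * |M| / z ≤ ε / 4 := by
      rw [div_le_iff₀ hzpos, mul_div_assoc', div_mul_eq_mul_div, div_le_iff₀ (by positivity)]
      nlinarith [abs_nonneg M, mul_pos hε hzpos]
    refine le_trans ?_ this
    gcongr
  refine SS_bound μ shift_cont (shift_mp hμ) (sl2_cont hA) (phi_cont N a) (fun x => det_sl (A x)) (norm_phi N a) η hη hη2 δ hδ ?_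
  intro lam hl
  refine SS_tendsto hμ A hA (phi N a) (norm_phi N a) (phi_cont N a) η hη hη2 lam (by linarith) M hM ?_
  intro t ht
  by_contra hpos
  push Not at hpos
  apply hneg
  have ht' : |t| ≤ η := abs_le.2 ht
  have hq : |η^2 - t^2| ≤ η^2 := by
    have := sq_abs t
    rw [abs_le]; constructor <;> nlinarith [abs_nonneg t]
  have hs : |lam * (η^2 - t^2)| ≤ δ * η^2 := by
    rw [abs_mul]; exact mul_le_mul hl.le hq (abs_nonneg _) hδ.le
  have hs2 : |lam * (η^2 - t^2)| ≤ δ := hs.trans (mul_le_of_le_one_right hδ.le (by nlinarith))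
  have hs3 : |lam * (η^2 - t^2)| ≤ η :=
    hs.trans ((mul_le_of_le_one_left (sq_nonneg η) hδ1).trans (by nlinarith))
  obtain ⟨h1, h2⟩ := close_lemma hζ hγ A |M| |H0| (abs_nonneg _) (abs_nonneg _) hM' hH N a t (lam * (η^2 - t^2)) (6 * η) (by linarith) (by linarith) (by linarith)
  refine ⟨_, BB_cont A hA _ (norm_phi N a) (phi_cont N a) t (lam * (η^2 - t^2)), h1, hpos, h2 ε ?_⟩
  have : 4 * |lam * (η^2 - t^2)| * |M| / z ≤ 4 * δ * |M| / z := by gcongr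
  linarith
end windows

/-- real-linear action on the complex plane -/
def actC (g : Mat2) (v : ℂ) : ℂ := al g * v + be g * star v

lemma actC_mul (g h : Mat2) (v : ℂ) : actC (g * h) v = actC g (actC h v) := by
  apply Complex.ext <;> simp [actC, al, be, Matrix.mul_apply, Fin.sum_univ_two] <;> ring

lemma actC_one (v : ℂ) : actC 1 v = v := by simp [actC, al_one, be_one]

lemma actC_cont (g : Mat2) : Continuous (actC g) := by unfold actC; fun_prop

def actL (g : Mat2) : ℂ →ₗ[ℝ] ℂ := Matrix.toLin Complex.basisOneI Complex.basisOneI g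

lemma actL_apply (g : Mat2) (v : ℂ) : actL g v = actC g v := by
  rw [actL, Matrix.toLin_apply]
  apply Complex.ext <;>
  simp [actC, al, be, Matrix.mulVec, dotProduct, Fin.sum_univ_two, Complex.coe_basisOneI_repr, Complex.coe_basisOneI] <;> ring

lemma actC_mp (g : Mat2) (hg : g.det = 1) : MeasurePreserving (actC g) volume volume := by
  refine ⟨(actC_cont g).measurable, ?_⟩
  have h1 : LinearMap.det (actL g) = 1 := by rw [actL, LinearMap.det_toLin, hg]
  have := Measure.map_linearMap_addHaar_eq_smul_addHaar (volume : Measure ℂ) (f := actL g) (by rw [h1]; norm_num)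
  rw [h1] at this
  have e : (⇑(actL g) : ℂ → ℂ) = actC g := funext (actL_apply g)
  rw [e] at this
  simpa using this

lemma actC_norm_le (g : Mat2) (hg : g.det = 1) (v : ℂ) : ‖actC g v‖ ≤ 2 * ‖al g‖ * ‖v‖ := by
  refine (norm_add_le _ _).trans ?_
  rw [norm_mul, norm_mul, norm_star]
  have := be_le_al g hg
  nlinarith [norm_nonneg v]

lemma norm_sq_H (C S : ℝ) (φ u : ℂ) (hφ : ‖φ‖ = 1) :
    ‖(C:ℂ) * u + φ * S * star u‖^2 = (C^2 + S^2) * ‖u‖^2 + 2 * C * S * (star φ * u^2).re := by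
  have h : φ.re^2 + φ.im^2 = 1 := by
    have := Complex.normSq_eq_norm_sq φ
    rw [hφ, Complex.normSq_apply] at this; nlinarith
  simp only [← Complex.normSq_eq_norm_sq, Complex.normSq_apply]
  simp [pow_two]
  linear_combination (S^2 * (u.re^2 + u.im^2)) * h

lemma Pert_norm_sq (t s : ℝ) (φ u : ℂ) (hφ : ‖φ‖ = 1) :
    ‖actC (Pert t s φ) u‖^2 = Real.cosh (2*s) * ‖u‖^2 + Real.sinh (2*s) * (star φ * u^2).re := by
  have e : actC (Pert t s φ) u = Complex.exp (-(Complex.I * t)) * (((Real.cosh s : ℝ):ℂ) * u + φ * ((Real.sinh s : ℝ) : ℂ) * star u) := by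
    rw [actC, Pert, al_mkM, be_mkM, Complex.ofReal_cosh, Complex.ofReal_sinh]; ring
  rw [e, norm_mul, norm_expI, one_mul, norm_sq_H _ _ _ _ hφ, Real.cosh_two_mul, Real.sinh_two_mul]
  ring

/-- scalar inequality behind the spectral gap -/
lemma pair_ineq (C S x : ℝ) (hC : 0 < C) (hCS : C^2 - S^2 = 1) (hx : x^2 ≤ 1) (P Q : ℝ) (hP : 0 < P) (hQ : 0 < Q)
    (hP2 : P^2 = C + S * x) (hQ2 : Q^2 = C - S * x) :
    (1/P + 1/Q)^2 = 2 * C / (1 + S^2 * (1 - x^2)) + 2 / Real.sqrt (1 + S^2 * (1 - x^2)) := by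
  have h1 : (P * Q)^2 = 1 + S^2 * (1 - x^2) := by
    rw [mul_pow, hP2, hQ2]; nlinarith
  have h2 : Real.sqrt (1 + S^2 * (1 - x^2)) = P * Q := by
    rw [← h1]; exact Real.sqrt_sq (by positivity)
  rw [h2, ← h1]
  have : C = (P^2 + Q^2)/2 := by rw [hP2, hQ2]; ring
  rw [this]; field_simp; ring

lemma inv_le_poly (y : ℝ) (hy : 0 ≤ y) : 1 / (1 + y) ≤ 1 - y + y^2 := by
  rw [div_le_iff₀ (by linarith)]; nlinarith [pow_nonneg hy 3]

lemma inv_sqrt_le_poly (y : ℝ) (hy : 0 ≤ y) (hy1 : y ≤ 1) : 1 / Real.sqrt (1 + y) ≤ 1 - y/2 + 3 * y^2/8 := by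
  have h0 : 0 < Real.sqrt (1 + y) := Real.sqrt_pos.2 (by linarith)
  have hp : 0 < 1 - y/2 + 3 * y^2/8 := by nlinarith
  rw [div_le_iff₀ h0]
  have h2 : (1 - y/2 + 3 * y^2/8) * Real.sqrt (1 + y) = Real.sqrt ((1 - y/2 + 3 * y^2/8)^2 * (1 + y)) := by
    rw [Real.sqrt_mul (by positivity), Real.sqrt_sq hp.le]
  rw [h2]
  apply Real.one_le_sqrt.2
  have : (1 - y/2 + 3 * y^2/8)^2 * (1 + y) - 1 = y^3 * (5/8 - 15/64 * y + 9/64 * y^2) := by ring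
  have h3 : 0 ≤ 5/8 - 15/64 * y + 9/64 * y^2 := by nlinarith
  have := mul_nonneg (pow_nonneg hy 3) h3
  linarith

lemma aux_avg (a b c d : ℝ) : (1/4 * (a + b + c + d))^2 ≤ 1/8 * ((a + c)^2 + (b + d)^2) := by
  nlinarith [sq_nonneg ((a + c) - (b + d))]

set_option maxHeartbeats 1000000 in
lemma four_ineq (C S x y : ℝ) (hC : 0 < C) (hCS : C^2 - S^2 = 1) (hxy : x^2 + y^2 = 1) (hS : S^2 ≤ 1/10)
    (P : Fin 4 → ℝ) (hP : ∀ j, 0 < P j)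
    (h0 : (P 0)^2 = C + S * x) (h1 : (P 1)^2 = C + S * y) (h2 : (P 2)^2 = C - S * x) (h3 : (P 3)^2 = C - S * y) :
    (1/4 * ∑ j, 1 / P j)^2 ≤ 1 - S^2 / 10 := by
  have a1 := pair_ineq C S x hC hCS (by nlinarith) (P 0) (P 2) (hP 0) (hP 2) h0 h2
  have a2 := pair_ineq C S y hC hCS (by nlinarith) (P 1) (P 3) (hP 1) (hP 3) h1 h3
  have e1 : 1 - x^2 = y^2 := by linarith
  have e2 : 1 - y^2 = x^2 := by linarith
  rw [e1] at a1; rw [e2] at a2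
  set q := S^2 with hq
  have hq0 : 0 ≤ q := sq_nonneg S
  have hx1 : 0 ≤ x^2 := sq_nonneg x
  have hy1 : 0 ≤ y^2 := sq_nonneg y
  have b1 := inv_le_poly (q * y^2) (by positivity)
  have b2 := inv_le_poly (q * x^2) (by positivity)
  have b3 := inv_sqrt_le_poly (q * y^2) (by positivity) (by nlinarith)
  have b4 := inv_sqrt_le_poly (q * x^2) (by positivity) (by nlinarith)
  have hC2 : C ≤ 1 + q/2 := by
    by_contra hcon
    push Not at hcon
    nlinarith
  have f1 : 2 * C / (1 + q * y^2) = 2 * C * (1 / (1 + q * y^2)) := by ring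
  have f2 : 2 * C / (1 + q * x^2) = 2 * C * (1 / (1 + q * x^2)) := by ring
  have f3 : 2 / Real.sqrt (1 + q * y^2) = 2 * (1 / Real.sqrt (1 + q * y^2)) := by ring
  have f4 : 2 / Real.sqrt (1 + q * x^2) = 2 * (1 / Real.sqrt (1 + q * x^2)) := by ring
  rw [f1, f3] at a1; rw [f2, f4] at a2
  have hx4 : (q*x^2)^2 + (q * y^2)^2 ≤ q^2 := by
    have : q^2 = q^2 * (x^2+y^2)^2 := by rw [hxy]; ring
    have h := mul_nonneg (mul_nonneg (sq_nonneg q) hx1) hy1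
    nlinarith
  have g1 : 1 / (1 + q * y^2) + 1 / (1 + q * x^2) ≤ 2 - q + q^2 := by
    have : q * x^2 + q * y^2 = q := by rw [← mul_add, hxy, mul_one]
    linarith
  have g2 : 1 / Real.sqrt (1 + q * y^2) + 1 / Real.sqrt (1 + q * x^2) ≤ 2 - q/2 + 3 * q^2/8 := by
    have : q * x^2 + q * y^2 = q := by rw [← mul_add, hxy, mul_one]
    linarith
  have g3 : C * (1 / (1 + q * y^2) + 1 / (1 + q * x^2)) ≤ (1 + q/2) * (2 - q + q^2) := by
    apply mul_le_mul hC2 g1 (by positivity) (by positivity)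
  have g4 : (1/4 * ∑ j, 1 / P j)^2 ≤ 1/8 * ((1/P 0 + 1/P 2)^2 + (1/P 1 + 1/P 3)^2) := by
    rw [Fin.sum_univ_four]
    exact aux_avg _ _ _ _
  rw [a1, a2] at g4
  have g5 : (1 + q/2) * (2 - q + q^2) + (2 - q/2 + 3 * q^2/8) ≤ 4 - 4/10 * q := by
    nlinarith [pow_nonneg hq0 3, mul_nonneg hq0 hq0]
  refine g4.trans ?_
  have e : 1/8 * (2 * C * (1 / (1 + q * y^2)) + 2 * (1 / Real.sqrt (1 + q * y^2)) + (2 * C * (1 / (1 + q * x^2)) + 2 * (1 / Real.sqrt (1 + q * x^2)))) = 1/4 * (C * (1 / (1 + q * y^2) + 1 / (1 + q * x^2)) + (1 / Real.sqrt (1 + q * y^2) + 1 / Real.sqrt (1 + q * x^2))) := by ring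
  rw [e]
  linarith

lemma avg_aux (C S r : ℝ) (hC : 0 < C) (hCS : C^2 - S^2 = 1) (hS : S^2 ≤ 1/10) (hr : 1 - S^2/10 ≤ r) (u : ℂ) (hu : u ≠ 0)
    (P : Fin 4 → ℝ) (hP : ∀ j, 0 ≤ P j) (h : ∀ j, (P j)^2 = C * ‖u‖^2 + S * (star (ph j) * u^2).re) :
    (∀ j, 0 < P j) ∧ 1/4 * ∑ j, 1 / P j ≤ Real.sqrt r * (1 / ‖u‖) := by
  have hu0 : 0 < ‖u‖ := norm_pos_iff.2 hu
  set w := u^2 with hw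
  have hwn : w.re^2 + w.im^2 = (‖u‖^2)^2 := by
    rw [← norm_pow, ← Complex.normSq_eq_norm_sq, Complex.normSq_apply]; ring
  set m := ‖u‖^2 with hm
  have hm0 : 0 < m := by positivity
  set x := w.re / m with hx
  set y := w.im / m with hy
  have hwr : w.re = x * m := by rw [hx]; field_simp
  have hwi : w.im = y * m := by rw [hy]; field_simp
  have hxy : x^2 + y^2 = 1 := by
    rw [hx, hy, div_pow, div_pow, ← add_div, hwn]; field_simp
  have k0 : (P 0)^2 = (C + S * x) * m := by rw [h]; simp [ph, hwr]; ring
  have k1 : (P 1)^2 = (C + S * y) * m := by rw [h]; simp [ph, hwi]; ring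
  have k2 : (P 2)^2 = (C - S * x) * m := by rw [h]; simp [ph, hwr]; ring
  have k3 : (P 3)^2 = (C - S * y) * m := by
    rw [h]
    have : star (ph 3) = Complex.I := by
      simp [ph, pow_succ]
    rw [this]; simp [hwi]; ring
  have key : ∀ z : ℝ, z^2 ≤ 1 → 0 < C + S * z := by
    intro z hz
    by_contra hcon
    push Not at hcon
    have h1 : C ≤ -(S * z) := by linarith
    have h2 : C^2 ≤ (S*z)^2 := by nlinarith
    have h3 : (S * z)^2 ≤ S^2 := by rw [mul_pow]; nlinarith [sq_nonneg S]
    linarith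
  have hpos : ∀ j, 0 < P j := by
    intro j
    refine lt_of_le_of_ne (hP j) fun h0 => ?_
    have hj : (P j)^2 = 0 := by rw [← h0]; simp
    have q0 := mul_pos (key x (by nlinarith)) hm0
    have q1 := mul_pos (key y (by nlinarith)) hm0
    have q2 := mul_pos (key (-x) (by nlinarith)) hm0
    have q3 := mul_pos (key (-y) (by nlinarith)) hm0
    have e2 : C + S * -x = C - S * x := by ring
    have e3 : C + S * -y = C - S * y := by ring
    rw [e2] at q2; rw [e3] at q3
    fin_cases j
    · exact q0.ne' (k0.symm.trans hj)
    · exact q1.ne' (k1.symm.trans hj)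
    · exact q2.ne' (k2.symm.trans hj)
    · exact q3.ne' (k3.symm.trans hj)
  refine ⟨hpos, ?_⟩
  have := four_ineq C S x y hC hCS hxy hS (fun j => P j / ‖u‖) (fun j => div_pos (hpos j) hu0)
    (by rw [div_pow, k0, ← hm]; field_simp) (by rw [div_pow, k1, ← hm]; field_simp)
    (by rw [div_pow, k2, ← hm]; field_simp) (by rw [div_pow, k3, ← hm]; field_simp)
  have h2 := Real.le_sqrt_of_sq_le (this.trans hr)
  have e : 1/4 * ∑ j, 1 / (P j / ‖u‖) = (1/4 * ∑ j, 1 / P j) * ‖u‖ := by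
    rw [Fin.sum_univ_four, Fin.sum_univ_four]; field_simp
  rw [e] at h2
  rw [mul_one_div, le_div_iff₀ hu0]; exact h2

/-- inverse of the action of the perturbing matrix -/
def KK (t s : ℝ) (φ : ℂ) (w : ℂ) : ℂ :=
  ((Real.cosh s : ℝ):ℂ) * (Complex.exp (Complex.I * t) * w) + φ * ((-Real.sinh s : ℝ) : ℂ) * star (Complex.exp (Complex.I * t) * w)

lemma KK_cont (t s : ℝ) (φ : ℂ) : Continuous (KK t s φ) := by unfold KK; fun_prop

lemma KK_act (t s : ℝ) (φ : ℂ) (hφ : ‖φ‖ = 1) (v : ℂ) : KK t s φ (actC (Pert t s φ) v) = v := by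
  have e : Complex.exp (Complex.I * t) * actC (Pert t s φ) v = (((Real.cosh s : ℝ):ℂ) * v + φ * ((Real.sinh s : ℝ) : ℂ) * star v) := by
    rw [actC, Pert, al_mkM, be_mkM, Complex.ofReal_cosh, Complex.ofReal_sinh]
    have : Complex.exp (Complex.I * t) * Complex.exp (-(Complex.I * t)) = 1 := by rw [← Complex.exp_add]; simp
    linear_combination (Complex.cosh s * v + φ * Complex.sinh s * star v) * this
  have hh : φ * star φ = 1 := by
    have := Complex.mul_conj φ
    rw [Complex.normSq_eq_norm_sq, hφ] at this
    simpa using this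
  have hcs : ((Real.cosh s : ℝ):ℂ)^2 - ((Real.sinh s : ℝ):ℂ)^2 = 1 := by
    exact_mod_cast Real.cosh_sq_sub_sinh_sq s
  rw [KK, e]
  simp only [star_add, star_mul', star_star, Complex.ofReal_neg]
  have c1 : star ((Real.cosh s : ℝ):ℂ) = ((Real.cosh s : ℝ):ℂ) := Complex.conj_ofReal _
  have c2 : star ((Real.sinh s : ℝ):ℂ) = ((Real.sinh s : ℝ):ℂ) := Complex.conj_ofReal _
  rw [c1, c2]
  linear_combination v * hcs - ((Real.sinh s : ℝ):ℂ)^2 * v * hh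

lemma KK_norm_sq (t s : ℝ) (φ w : ℂ) (hφ : ‖φ‖ = 1) :
    ‖KK t s φ w‖^2 = Real.cosh (2*s) * ‖Complex.exp (Complex.I * t) * w‖^2 + (-Real.sinh (2*s)) * (star φ * (Complex.exp (Complex.I * t) * w)^2).re := by
  rw [KK, norm_sq_H _ _ _ _ hφ, Real.cosh_two_mul, Real.sinh_two_mul]
  ring

section schur
variable (t s r : ℝ) 

lemma schur (hS : (Real.sinh (2*s))^2 ≤ 1/10) (hr : 1 - (Real.sinh (2*s))^2/10 ≤ r) (f : ℂ → ℝ) (hf : Measurable f) :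
    ∫⁻ v, ENNReal.ofReal ((1/4 * ∑ j, f (actC (Pert t s (ph j)) v))^2) ≤ ENNReal.ofReal r * ∫⁻ v, ENNReal.ofReal ((f v)^2) := by
  have hC := Real.cosh_pos (2*s)
  have hCS := Real.cosh_sq_sub_sinh_sq (2*s)
  have hr0 : 0 ≤ r := by linarith
  set ρ := Real.sqrt r with hρ
  have hρ0 : 0 ≤ ρ := Real.sqrt_nonneg _
  have hρ2 : ρ * ρ = r := Real.mul_self_sqrt hr0
  have i1 : ∀ u : ℂ, u ≠ 0 → (∀ j, 0 < ‖actC (Pert t s (ph j)) u‖) ∧ 1/4 * ∑ j, 1 / ‖actC (Pert t s (ph j)) u‖ ≤ ρ * (1/‖u‖) :=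
    fun u hu => avg_aux _ _ r hC hCS hS hr u hu _ (fun j => norm_nonneg _) (fun j => Pert_norm_sq t s _ u (norm_ph j))
  have i2 : ∀ w : ℂ, w ≠ 0 → 1/4 * ∑ j, 1 / ‖KK t s (ph j) w‖ ≤ ρ * (1/‖w‖) := by
    intro w hw
    have hn : ‖Complex.exp (Complex.I * t) * w‖ = ‖w‖ := by
      rw [norm_mul, mul_comm Complex.I, Complex.norm_exp_ofReal_mul_I, one_mul]
    have := (avg_aux (Real.cosh (2*s)) (-Real.sinh (2*s)) r hC (by rw [neg_sq]; exact hCS) (by rw [neg_sq]; exact hS) (by rw [neg_sq]; exact hr)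
      (Complex.exp (Complex.I * t) * w) (mul_ne_zero (Complex.exp_ne_zero _) hw) _ (fun j => norm_nonneg _) (fun j => KK_norm_sq t s _ w (norm_ph j))).2
    rwa [hn] at this
  let G : Fin 4 → ℂ → ℝ := fun j w => ρ/4 * (1 / ‖KK t s (ph j) w‖ * ((f w)^2 * ‖w‖))
  have hG0 : ∀ j w, 0 ≤ G j w := fun j w => by positivity
  have hGm : ∀ j, Measurable (G j) := by
    intro j
    have := (KK_cont t s (ph j)).measurable
    simp only [G]
    fun_prop
  have hmp := fun j => actC_mp (Pert t s (ph j)) (Pert_det t s _ (norm_ph j))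
  calc ∫⁻ v, ENNReal.ofReal ((1/4 * ∑ j, f (actC (Pert t s (ph j)) v))^2)
      ≤ ∫⁻ v, ∑ j, ENNReal.ofReal (G j (actC (Pert t s (ph j)) v)) := by
        refine lintegral_mono_ae ?_
        have : ∀ᵐ v : ℂ, v ≠ 0 := by simp [ae_iff]
        filter_upwards [this] with v hv
        rw [← ENNReal.ofReal_sum_of_nonneg (fun j _ => hG0 j _)]
        apply ENNReal.ofReal_le_ofReal
        obtain ⟨hb, h1⟩ := i1 v hv
        have cs := Finset.sum_sq_le_sum_mul_sum_of_sq_eq_mul Finset.univ (r := fun j => f (actC (Pert t s (ph j)) v))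
          (f := fun j => 1 / ‖actC (Pert t s (ph j)) v‖) (g := fun j => (f (actC (Pert t s (ph j)) v))^2 * ‖actC (Pert t s (ph j)) v‖)
          (fun j _ => by positivity) (fun j _ => by positivity) (fun j _ => by have := (hb j).ne'; field_simp)
        have e : ∑ j, G j (actC (Pert t s (ph j)) v) = ρ * (1/‖v‖) * (1/4 * ∑ j, (f (actC (Pert t s (ph j)) v))^2 * ‖actC (Pert t s (ph j)) v‖) := by
          simp only [G, KK_act t s _ (norm_ph _), Finset.mul_sum]
          refine Finset.sum_congr rfl fun j _ => ?_
          ring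
        rw [e]
        have h2 := mul_le_mul_of_nonneg_right h1 (show 0 ≤ 1/4 * ∑ j, (f (actC (Pert t s (ph j)) v))^2 * ‖actC (Pert t s (ph j)) v‖ from
          mul_nonneg (by norm_num) (Finset.sum_nonneg fun j _ => by positivity))
        refine le_trans ?_ h2
        rw [mul_pow]
        linarith
    _ = ∑ j, ∫⁻ v, ENNReal.ofReal (G j (actC (Pert t s (ph j)) v)) := by
        refine lintegral_finsetSum _ fun j _ => ?_
        exact ((hGm j).comp (actC_cont _).measurable).ennreal_ofReal
    _ = ∑ j, ∫⁻ w, ENNReal.ofReal (G j w) := by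
        refine Finset.sum_congr rfl fun j _ => ?_
        exact (hmp j).lintegral_comp (hGm j).ennreal_ofReal
    _ = ∫⁻ w, ∑ j, ENNReal.ofReal (G j w) := (lintegral_finsetSum _ fun j _ => (hGm j).ennreal_ofReal).symm
    _ ≤ ∫⁻ w, ENNReal.ofReal r * ENNReal.ofReal ((f w)^2) := by
        refine lintegral_mono fun w => ?_
        rw [← ENNReal.ofReal_sum_of_nonneg (fun j _ => hG0 j _), ← ENNReal.ofReal_mul hr0]
        apply ENNReal.ofReal_le_ofReal
        have e : ∑ j, G j w = ρ * ((1/4 * ∑ j, 1 / ‖KK t s (ph j) w‖) * ((f w)^2 * ‖w‖)) := by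
          simp only [G, Finset.mul_sum, Finset.sum_mul]
          refine Finset.sum_congr rfl fun j _ => ?_
          ring
        rw [e]
        by_cases hw : w = 0
        · rw [hw]; simp; positivity
        · have hw0 : 0 < ‖w‖ := norm_pos_iff.2 hw
          have := mul_le_mul_of_nonneg_left (mul_le_mul_of_nonneg_right (i2 w hw) (show 0 ≤ (f w)^2 * ‖w‖ by positivity)) hρ0
          refine this.trans (le_of_eq ?_)
          rw [← hρ2]; field_simp
    _ = ENNReal.ofReal r * ∫⁻ v, ENNReal.ofReal ((f v)^2) := lintegral_const_mul _ (hf.pow_const 2).ennreal_ofReal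

end schur

section avg
variable (t s : ℝ)

/-- averaged indicator of the unit ball -/
def FF : List Mat2 → ℂ → ℝ
  | [], v => (Metric.closedBall (0:ℂ) 1).indicator (fun _ => (1:ℝ)) v
  | g :: l, v => 1/4 * ∑ j, FF l (actC (Pert t s (ph j) * g) v)

/-- expectation of a function of the random product -/
def EE : List Mat2 → (Mat2 → ℝ) → ℝ
  | [], Φ => Φ 1
  | g :: l, Φ => 1/4 * ∑ j, EE l (fun P => Φ (P * (Pert t s (ph j) * g)))

lemma FF_meas (l : List Mat2) : Measurable (FF t s l) := by
  induction l with
  | nil => exact measurable_const.indicator measurableSet_closedBall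
  | cons g l ih =>
    change Measurable fun v => 1/4 * ∑ j, FF t s l (actC (Pert t s (ph j) * g) v)
    refine (Finset.measurable_sum _ fun j _ => ?_).const_mul _
    exact ih.comp (actC_cont _).measurable

lemma FF_nonneg (l : List Mat2) (v : ℂ) : 0 ≤ FF t s l v := by
  induction l generalizing v with
  | nil => exact Set.indicator_nonneg (fun _ _ => zero_le_one) _
  | cons g l ih => exact mul_nonneg (by norm_num) (Finset.sum_nonneg fun j _ => ih _)

lemma FF_int (r : ℝ) (hS : (Real.sinh (2*s))^2 ≤ 1/10) (hr : 1 - (Real.sinh (2*s))^2/10 ≤ r) (l : List Mat2) (hl : ∀ g ∈ l, g.det = 1) :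
    ∫⁻ v, ENNReal.ofReal ((FF t s l v)^2) ≤ ENNReal.ofReal (r ^ l.length) * volume (Metric.closedBall (0:ℂ) 1) := by
  have hr0 : 0 ≤ r := by linarith
  induction l with
  | nil =>
    simp only [List.length_nil, pow_zero, ENNReal.ofReal_one, one_mul]
    rw [← lintegral_indicator_one measurableSet_closedBall]
    refine le_of_eq (lintegral_congr fun v => ?_)
    by_cases hv : v ∈ Metric.closedBall (0:ℂ) 1 <;> simp only [FF, Set.indicator, hv] <;> simp
  | cons g l ih =>
    have h1 := schur t s r hS hr (FF t s l) (FF_meas t s l)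
    have h2 : ∫⁻ v, ENNReal.ofReal ((FF t s (g :: l) v)^2) = ∫⁻ v, ENNReal.ofReal ((1/4 * ∑ j, FF t s l (actC (Pert t s (ph j)) v))^2) := by
      refine Eq.trans ?_ ((actC_mp g (hl g (by simp))).lintegral_comp (f := fun v => ENNReal.ofReal ((1/4 * ∑ j, FF t s l (actC (Pert t s (ph j)) v))^2)) ?_)
      · simp only [FF, actC_mul]
      · refine Measurable.ennreal_ofReal (Measurable.pow_const ?_ 2)
        refine (Finset.measurable_sum _ fun j _ => ?_).const_mul _
        exact (FF_meas t s l).comp (actC_cont _).measurable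
    rw [h2]
    refine h1.trans ?_
    rw [List.length_cons, pow_succ', ENNReal.ofReal_mul hr0, mul_assoc]
    gcongr
    exact ih fun g hg => hl g (by simp [hg])

lemma EE_chi (l : List Mat2) (v : ℂ) :
    EE t s l (fun P => (Metric.closedBall (0:ℂ) 1).indicator (fun _ => (1:ℝ)) (actC P v)) = FF t s l v := by
  induction l generalizing v with
  | nil => simp [EE, FF, actC_one]
  | cons g l ih =>
    simp only [EE, FF, actC_mul]
    congr 1
    refine Finset.sum_congr rfl fun j _ => ?_
    exact ih _

lemma EE_mono (l : List Mat2) (hl : ∀ g ∈ l, g.det = 1) (Φ Ψ : Mat2 → ℝ) (h : ∀ P : Mat2, P.det = 1 → Φ P ≤ Ψ P) :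
    EE t s l Φ ≤ EE t s l Ψ := by
  induction l generalizing Φ Ψ with
  | nil => exact h 1 (by simp)
  | cons g l ih =>
    simp only [EE]
    refine mul_le_mul_of_nonneg_left (Finset.sum_le_sum fun j _ => ?_) (by norm_num)
    refine ih (fun g hg => hl g (by simp [hg])) _ _ fun P hP => h _ ?_
    rw [Matrix.det_mul, Matrix.det_mul, hP, Pert_det t s _ (norm_ph j), hl g (by simp)]; norm_num

lemma EE_affine (l : List Mat2) (a b : ℝ) (Φ : Mat2 → ℝ) :
    EE t s l (fun P => a + b * Φ P) = a + b * EE t s l Φ := by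
  induction l generalizing Φ with
  | nil => rfl
  | cons g l ih =>
    simp only [EE]
    have := fun j => ih (fun P => Φ (P * (Pert t s (ph j) * g)))
    simp only [this, Finset.sum_add_distrib, ← Finset.mul_sum]
    simp; ring

lemma EE_small (r : ℝ) (hS : (Real.sinh (2*s))^2 ≤ 1/10) (hr : 1 - (Real.sinh (2*s))^2/10 ≤ r) (l : List Mat2) (hl : ∀ g ∈ l, g.det = 1)
    (R : ℝ) (hR : 0 < R) :
    (EE t s l (fun P => if ‖al P‖ ≤ R / 2 then 1 else 0))^2 ≤ r ^ l.length * R^2 := by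
  have hr0 : 0 ≤ r := by linarith
  set q := EE t s l (fun P => if ‖al P‖ ≤ R / 2 then 1 else 0) with hq
  have hq0 : 0 ≤ q := by
    have := EE_mono t s l hl (fun P => 0 + 0 * 0) (fun P => if ‖al P‖ ≤ R / 2 then 1 else 0) (fun P _ => by split_ifs <;> norm_num)
    rw [EE_affine] at this; simpa using this
  have hlow : ∀ v ∈ Metric.closedBall (0:ℂ) (1/R), q ≤ FF t s l v := by
    intro v hv
    rw [← EE_chi]
    refine EE_mono t s l hl _ _ fun P hP => ?_
    split_ifs with h
    · rw [Set.indicator_of_mem]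
      rw [mem_closedBall_zero_iff] at hv ⊢
      refine (actC_norm_le P hP v).trans ?_
      calc 2 * ‖al P‖ * ‖v‖ ≤ 2 * (R/2) * (1/R) := by gcongr
        _ = 1 := by field_simp
    · exact Set.indicator_nonneg (fun _ _ => zero_le_one) _
  have h1 := FF_int t s r hS hr l hl
  have h2 : ENNReal.ofReal (q^2) * volume (Metric.closedBall (0:ℂ) (1/R)) ≤ ∫⁻ v, ENNReal.ofReal ((FF t s l v)^2) := by
    rw [← setLIntegral_const]
    refine le_trans ?_ (setLIntegral_le_lintegral (Metric.closedBall (0:ℂ) (1/R)) _)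
    refine setLIntegral_mono' measurableSet_closedBall fun v hv => ?_
    apply ENNReal.ofReal_le_ofReal
    exact pow_le_pow_left₀ hq0 (hlow v hv) 2
  have h3 := h2.trans h1
  rw [Complex.volume_closedBall, Complex.volume_closedBall, ← mul_assoc, ← mul_assoc, ENNReal.ofReal_one, one_pow, mul_one,
    ← ENNReal.ofReal_pow (by positivity), ← ENNReal.ofReal_mul (by positivity)] at h3
  have h4 : ENNReal.ofReal (q^2 * (1/R)^2) ≤ ENNReal.ofReal (r ^ l.length) := by
    refine (ENNReal.mul_le_mul_iff_left ?_ ?_).1 h3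
    · simp [NNReal.pi_pos.ne']
    · simp
  rw [ENNReal.ofReal_le_ofReal_iff (by positivity)] at h4
  calc q^2 = (q^2 * (1/R)^2) * R^2 := by field_simp
    _ ≤ _ := by gcongr

lemma EE_log (r : ℝ) (hS : (Real.sinh (2*s))^2 ≤ 1/10) (hr : 1 - (Real.sinh (2*s))^2/10 ≤ r) (l : List Mat2) (hl : ∀ g ∈ l, g.det = 1)
    (K : ℝ) (hK : 0 ≤ K) (hR : r ^ l.length * (2 * Real.exp K)^2 ≤ 1/4) :
    K / 2 ≤ EE t s l (fun P => Real.log ‖al P‖) := by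
  have h1 := EE_small t s r hS hr l hl (2 * Real.exp K) (by positivity)
  have h2 := h1.trans hR
  set q := EE t s l (fun P => if ‖al P‖ ≤ 2 * Real.exp K / 2 then 1 else 0) with hq
  have hq2 : q ≤ 1/2 := by nlinarith
  have h3 := EE_mono t s l hl (fun P => K + (-K) * (if ‖al P‖ ≤ 2 * Real.exp K / 2 then 1 else 0)) (fun P => Real.log ‖al P‖) (by
    intro P hP
    have := one_le_al P hP
    split_ifs with h
    · have := Real.log_nonneg this
      linarith
    · push Not at h
      have h' : Real.exp K ≤ ‖al P‖ := by linarith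
      have := Real.log_le_log (Real.exp_pos K) h'
      rw [Real.log_exp] at this; linarith)
  rw [EE_affine] at h3
  nlinarith

end avg

section counting
variable {W : Type*} [Fintype W] [DecidableEq W]

lemma count_swap (w : W) (G : (W → Fin 4) → Fin 4 → ℝ) (hG : ∀ a i j, G (Function.update a w i) j = G a j) :
    ∑ a, G a (a w) = 1/4 * ∑ j, ∑ a, G a j := by
  let e : (W → Fin 4) × Fin 4 → (W → Fin 4) × Fin 4 := fun p => (Function.update p.1 w p.2, p.1 w)
  have he : Function.Involutive e := by
    rintro ⟨a, j⟩
    simp [e]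
  have h1 := Equiv.sum_comp he.toPerm (fun p => G p.1 (p.1 w))
  simp only [Function.Involutive.coe_toPerm, e, Function.update_self, hG] at h1
  rw [Fintype.sum_prod_type, Fintype.sum_prod_type, Finset.sum_comm] at h1
  simp only [Finset.sum_const, Finset.card_univ, Fintype.card_fin, nsmul_eq_mul] at h1
  rw [h1, ← Finset.mul_sum]
  push_cast; ring

/-- product along a labelled list -/
def PP (t s : ℝ) (a : W → Fin 4) : List (W × Mat2) → Mat2
  | [] => 1
  | q :: l => PP t s a l * (Pert t s (ph (a q.1)) * q.2)

lemma PP_update (t s : ℝ) (a : W → Fin 4) (w : W) (i : Fin 4) (l : List (W × Mat2)) (h : w ∉ l.map Prod.fst) :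
    PP t s (Function.update a w i) l = PP t s a l := by
  induction l with
  | nil => rfl
  | cons q l ih =>
    simp only [List.map_cons, List.mem_cons, not_or] at h
    simp only [PP]
    rw [ih h.2, Function.update_of_ne (Ne.symm h.1)]

lemma PP_avg (t s : ℝ) (l : List (W × Mat2)) (h : (l.map Prod.fst).Nodup) (Φ : Mat2 → ℝ) :
    ∑ a : W → Fin 4, Φ (PP t s a l) = Fintype.card (W → Fin 4) * EE t s (l.map Prod.snd) Φ := by
  induction l generalizing Φ with
  | nil => simp [PP, EE]
  | cons q l ih =>
    simp only [List.map_cons, List.nodup_cons] at h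
    simp only [PP, List.map_cons, EE]
    rw [count_swap q.1 (fun a j => Φ (PP t s a l * (Pert t s (ph j) * q.2)))
      (fun a i j => by rw [PP_update t s a q.1 i l h.1])]
    have := fun j => ih h.2 (fun P => Φ (P * (Pert t s (ph j) * q.2)))
    simp only [this, ← Finset.mul_sum]
    ring
end counting

section orbit
variable {κ : ℕ}

/-- labelled orbit list -/
def orb (N : ℕ) (A : Sig κ → SL2) : ℕ → Sig κ → List (Win κ N × Mat2)
  | 0, _ => []
  | n + 1, x => (win N x, (A x : Mat2)) :: orb N A n (shift x)

lemma orb_length (N : ℕ) (A : Sig κ → SL2) (n : ℕ) (x : Sig κ) : (orb N A n x).length = n := by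
  induction n generalizing x with
  | zero => rfl
  | succ n ih => simp [orb, ih]

lemma orb_det (N : ℕ) (A : Sig κ → SL2) (n : ℕ) (x : Sig κ) : ∀ g ∈ (orb N A n x).map Prod.snd, g.det = 1 := by
  induction n generalizing x with
  | zero => simp [orb]
  | succ n ih =>
    intro g hg
    simp only [orb, List.map_cons, List.mem_cons] at hg
    rcases hg with rfl | hg
    · exact det_sl (A x)
    · exact ih _ g hg

lemma orb_PP (N : ℕ) (A : Sig κ → SL2) (a : Win κ N → Fin 4) (t s : ℝ) (n : ℕ) (x : Sig κ) :
    PP t s a (orb N A n x) = (cocycleN (BB A (phi N a) (norm_phi N a) t s) n x : SL2) := by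
  induction n generalizing x with
  | zero => simp [orb, PP, cocycleN]
  | succ n ih =>
    simp only [orb, PP, cocycleN, Matrix.SpecialLinearGroup.coe_mul]
    rw [ih, coe_BB]; rfl

/-- list of windows along the orbit -/
def wl (N : ℕ) : ℕ → Sig κ → List (Win κ N)
  | 0, _ => []
  | n + 1, x => win N x :: wl N n (shift x)

lemma orb_fst (N : ℕ) (A : Sig κ → SL2) (n : ℕ) (x : Sig κ) : (orb N A n x).map Prod.fst = wl N n x := by
  induction n generalizing x with
  | zero => rfl
  | succ n ih => simp [orb, wl, ih]

lemma mem_wl (N n : ℕ) (x : Sig κ) (w : Win κ N) (h : w ∈ wl N n x) : ∃ i < n, w = win N (shift^[i] x) := by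
  induction n generalizing x with
  | zero => simp [wl] at h
  | succ n ih =>
    simp only [wl, List.mem_cons] at h
    rcases h with rfl | h
    · exact ⟨0, by simp, rfl⟩
    · obtain ⟨i, hi, e⟩ := ih _ h
      exact ⟨i+1, by omega, by rw [e, Function.iterate_succ_apply]⟩

lemma win_cont (N : ℕ) : Continuous (win N : Sig κ → Win κ N) := by unfold win; fun_prop

lemma wl_cont (N n : ℕ) : IsClopen {x : Sig κ | (wl N n x).Nodup} := by
  have : ∀ P : List (Win κ N) → Prop, IsOpen {x : Sig κ | P (wl N n x)} := by
    induction n with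
    | zero => intro P; simp [wl]
    | succ n ih =>
      intro P
      have e : {x : Sig κ | P (wl N (n+1) x)} = ⋃ w : Win κ N, (win N ⁻¹' {w}) ∩ (shift ⁻¹' {x | P (w :: wl N n x)}) := by
        ext x; simp [wl]
      rw [e]
      refine isOpen_iUnion fun w => ((isOpen_discrete _).preimage (win_cont N)).inter ((ih (fun l => P (w :: l))).preimage shift_cont)
  refine ⟨⟨?_⟩, this _⟩
  exact this (fun l => ¬ l.Nodup)

lemma shift_iter (d : ℕ) (x : Sig κ) (m : ℤ) : (shift^[d] x) m = x (m + d) := by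
  induction d generalizing x m with
  | zero => simp
  | succ d ih => rw [Function.iterate_succ_apply, ih, shift]; congr 1; push_cast; ring

variable {p : Fin κ → ℝ} {μ : Measure (Sig κ)}

lemma noAtoms (hκ : 2 ≤ κ) (hp : ∀ i, 0 < p i) (hp1 : ∑ i, p i = 1) (hμ : IsBernoulli p μ) : NullSingletonClass μ := by
  have : Nonempty (Fin κ) := ⟨⟨0, by omega⟩⟩
  obtain ⟨i0, hi0⟩ := Finite.exists_max p
  have hlt : p i0 < 1 := by
    obtain ⟨j, hj⟩ : ∃ j : Fin κ, j ≠ i0 := by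
      have : Nontrivial (Fin κ) := Fin.nontrivial_iff_two_le.2 hκ
      exact exists_ne i0
    rw [← hp1]
    exact Finset.single_lt_sum (i := i0) (j := j) hj (Finset.mem_univ _) (Finset.mem_univ _) (hp j) (fun k _ _ => (hp k).le)
  refine ⟨fun x => ?_⟩
  have hb : ∀ n : ℕ, μ {x} ≤ (ENNReal.ofReal (p i0)) ^ n := by
    intro n
    let s : Finset ℤ := (Finset.range n).map ⟨fun k : ℕ => (k:ℤ), Nat.cast_injective⟩
    have h1 : μ {x} ≤ μ {y | ∀ m ∈ s, y m = x m} := measure_mono (by intro y hy; rw [Set.mem_singleton_iff.1 hy]; simp)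
    rw [hμ.2 s x] at h1
    refine h1.trans ?_
    refine (Finset.prod_le_pow_card s _ (ENNReal.ofReal (p i0)) fun m _ => ENNReal.ofReal_le_ofReal (hi0 _)).trans ?_
    simp [s]
  have ht := ENNReal.tendsto_pow_atTop_nhds_zero_of_lt_one (r := ENNReal.ofReal (p i0)) (by rw [← ENNReal.ofReal_one]; exact (ENNReal.ofReal_lt_ofReal_iff one_pos).2 hlt)
  exact le_antisymm (ge_of_tendsto' ht hb) zero_le

lemma per_null (hκ : 2 ≤ κ) (hp : ∀ i, 0 < p i) (hp1 : ∑ i, p i = 1) (hμ : IsBernoulli p μ) (d : ℕ) (hd : 0 < d) :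
    μ {x | x = shift^[d] x} = 0 := by
  have := noAtoms hκ hp hp1 hμ
  refine Set.Finite.measure_zero ?_ μ
  refine Set.Finite.of_injOn (f := fun (x : Sig κ) (i : Fin d) => x ((i:ℕ):ℤ)) (t := Set.univ) (fun _ _ => trivial) ?_ Set.finite_univ
  intro x hx y hy hxy
  have per : ∀ z : Sig κ, z = shift^[d] z → Function.Periodic z (d:ℤ) := by
    intro z hz m
    conv_rhs => rw [hz]
    rw [shift_iter]
  ext1 m
  have hm0 : 0 ≤ m % (d:ℤ) := Int.emod_nonneg _ (by omega)
  have hm1 : m % (d:ℤ) < d := Int.emod_lt_of_pos _ (by omega)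
  have red : ∀ z : Sig κ, Function.Periodic z (d:ℤ) → z m = z (m % (d:ℤ)) := by
    intro z hz
    have h := hz.int_mul (m / (d:ℤ)) (m % (d:ℤ))
    rw [← h]
    congr 1
    have := Int.emod_add_mul_ediv m (d:ℤ)
    simp only [Int.cast_id]
    linarith
  rw [red x (per x hx), red y (per y hy)]
  have := congrFun hxy ⟨(m % (d:ℤ)).toNat, by omega⟩
  simp only [Int.toNat_of_nonneg hm0] at this
  exact this

lemma win_tendsto (hκ : 2 ≤ κ) (hp : ∀ i, 0 < p i) (hp1 : ∑ i, p i = 1) (hμ : IsBernoulli p μ) (d : ℕ) (hd : 0 < d) :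
    Filter.Tendsto (fun N => μ {x | win N x = win N (shift^[d] x)}) Filter.atTop (nhds 0) := by
  have := hμ.1
  rw [← per_null hκ hp hp1 hμ d hd]
  have e : {x : Sig κ | x = shift^[d] x} = ⋂ N : ℕ, {x | win N x = win N (shift^[d] x)} := by
    ext x
    simp only [Set.mem_ofPred_eq, Set.mem_iInter]
    constructor
    · intro h N; rw [← h]
    · intro h
      ext1 m
      have h1 := congrFun (h m.natAbs) ⟨m, by rw [Finset.mem_Icc]; omega⟩
      exact h1
  rw [e]
  refine tendsto_measure_iInter_atTop (fun N => ?_) ?_ ⟨0, measure_ne_top _ _⟩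
  · exact (isClosed_eq (win_cont N) ((win_cont N).comp (shift_cont.iterate d))).measurableSet.nullMeasurableSet
  · intro N M hNM x hx
    simp only [Set.mem_ofPred_eq] at hx ⊢
    funext i
    have hi := Finset.mem_Icc.1 i.2
    exact congrFun hx ⟨i.1, by rw [Finset.mem_Icc]; omega⟩

lemma bad_tendsto (hκ : 2 ≤ κ) (hp : ∀ i, 0 < p i) (hp1 : ∑ i, p i = 1) (hμ : IsBernoulli p μ) (n : ℕ) :
    Filter.Tendsto (fun N => μ {x | ¬ (wl N n x).Nodup}) Filter.atTop (nhds 0) := by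
  induction n with
  | zero => simp [wl]
  | succ n ih =>
    have h2 := tendsto_finsetSum (Finset.range n) fun i _ => win_tendsto hκ hp hp1 hμ (i+1) (Nat.succ_pos i)
    have h3 := ih.add h2
    simp only [Finset.sum_const_zero, add_zero] at h3
    refine tendsto_of_tendsto_of_tendsto_of_le_of_le tendsto_const_nhds h3 (fun _ => zero_le) fun N => ?_
    have hsub : {x : Sig κ | ¬ (wl N (n+1) x).Nodup} ⊆ shift ⁻¹' {x | ¬ (wl N n x).Nodup} ∪ ⋃ i ∈ Finset.range n, {x | win N x = win N (shift^[i+1] x)} := by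
      intro x hx
      simp only [Set.mem_ofPred_eq, wl, List.nodup_cons, not_and_or, not_not] at hx
      rcases hx with hx | hx
      · right
        obtain ⟨i, hi, e⟩ := mem_wl N n _ _ hx
        simp only [Set.mem_iUnion]
        exact ⟨i, Finset.mem_range.2 hi, e⟩
      · left; exact hx
    refine (measure_mono hsub).trans ((measure_union_le _ _).trans ?_)
    refine add_le_add (le_of_eq ?_) (measure_biUnion_finset_le _ _)
    exact (shift_mp hμ).measure_preimage (wl_cont N n).compl.isOpen.measurableSet.nullMeasurableSet

end orbit

lemma sinh_bounds (η t : ℝ) (hη : 0 < η) (hη2 : η ≤ 1/100) (ht : |t| ≤ η/2) :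
    (Real.sinh (2 * (η^2 - t^2)))^2 ≤ 1/10 ∧ 1 - (Real.sinh (2 * (η^2 - t^2)))^2/10 ≤ 1 - η^4/10 := by
  have ht2 : t^2 ≤ η^2/4 := by
    have := sq_abs t
    nlinarith [abs_nonneg t]
  set y := 2 * (η^2 - t^2) with hy
  have hy0 : η^2 ≤ y := by nlinarith [sq_nonneg η]
  have hy1 : y ≤ 1/1000 := by nlinarith [sq_nonneg t]
  have hyn : 0 ≤ y := (sq_nonneg η).trans hy0
  have h1 : y ≤ Real.sinh y := Real.self_le_sinh_iff.2 hyn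
  have h2 : Real.sinh y ≤ 1/10 := by
    have a1 := Real.abs_exp_sub_one_sub_id_le (x := y) (by rw [abs_of_nonneg hyn]; linarith)
    have a2 := Real.add_one_le_exp (-y)
    have a3 := (abs_le.1 a1).2
    rw [Real.sinh_eq]
    nlinarith
  have h3 : 0 ≤ Real.sinh y := hyn.trans h1
  constructor
  · nlinarith
  · have : η^4 ≤ (Real.sinh y)^2 := by
      have := pow_le_pow_left₀ (sq_nonneg η) (hy0.trans h1) 2
      calc η^4 = (η^2)^2 := by ring
        _ ≤ _ := this
    linarith

section fin
variable {κ : ℕ} {p : Fin κ → ℝ} {μ : Measure (Sig κ)}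

lemma sum_vv_ge (hμ : IsBernoulli p μ) (A : Sig κ → SL2) (hA : Continuous A) (η : ℝ) (hη : 0 < η) (hη2 : η ≤ 1/100)
    (K : ℝ) (hK : 0 ≤ K) (n N : ℕ) (hn : (1 - η^4/10)^n * (2 * Real.exp K)^2 ≤ 1/4)
    (hN : μ {x | ¬ (wl N n x).Nodup} ≤ 1/2) (t : ℝ) (ht : |t| ≤ η/2) :
    Fintype.card (Win κ N → Fin 4) * (K/4) ≤ ∑ a : Win κ N → Fin 4, vv μ shift (fun x => (A x : Mat2)) (phi N a) n ((t:ℂ), ((1:ℝ):ℂ) * qf η t) := by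
  have := hμ.1
  have hDom := real_path_mem η hη hη2 1 (by norm_num) t (by rw [Set.mem_Icc, ← abs_le]; linarith)
  set c : ℝ := ((Fintype.card (Win κ N → Fin 4) : ℕ) : ℝ) with hc
  have hc0 : 0 ≤ c := Nat.cast_nonneg _
  unfold vv
  have hcont := fun a => logff_cont shift_cont (sl2_cont hA) (phi_cont N a) (fun x => det_sl (A x)) (norm_phi N a) n hDom
  rw [← integral_finsetSum _ fun a _ => integrable_of_cont μ (hcont a)]
  have hG := (wl_cont (κ := κ) N n).isOpen.measurableSet
  have hm : (1/2 : ℝ) ≤ μ.real {x | (wl N n x).Nodup} := by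
    have h1 := probReal_compl_eq_one_sub (μ := μ) hG
    have h2 : μ.real {x | (wl N n x).Nodup}ᶜ ≤ 1/2 := by
      have h3 := ENNReal.toReal_mono (by simp) hN
      have e : (1/2 : ENNReal).toReal = 1/2 := by simp
      rw [e] at h3
      exact h3
    linarith
  calc c * (K/4) = (1/2) * (c * (K/2)) := by ring
    _ ≤ μ.real {x | (wl N n x).Nodup} * (c * (K/2)) := by gcongr
    _ = ∫ x, ({x : Sig κ | (wl N n x).Nodup}).indicator (fun _ => c * (K/2)) x ∂μ := by
        rw [integral_indicator_const _ hG, smul_eq_mul]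
    _ ≤ _ := by
        refine integral_mono ((integrable_const _).indicator hG) (integrable_finset_sum _ fun a _ => integrable_of_cont μ (hcont a)) fun x => ?_
        rw [real_path_eq]
        simp only [fun a => al_coc A (phi N a) (norm_phi N a)]
        by_cases hx : x ∈ {x : Sig κ | (wl N n x).Nodup}
        · rw [Set.indicator_of_mem hx]
          have h1 := PP_avg t (1 * (η^2 - t^2)) (orb N A n x) (by rw [orb_fst]; exact hx) (fun P => Real.log ‖al P‖)
          simp only [orb_PP] at h1
          rw [h1]
          obtain ⟨s1, s2⟩ := sinh_bounds η t hη hη2 ht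
          rw [← one_mul (η^2 - t^2)] at s1 s2
          have h2 := EE_log t (1 * (η^2 - t^2)) _ s1 s2 ((orb N A n x).map Prod.snd) (orb_det N A n x) K hK
            (by rw [List.length_map, orb_length]; exact hn)
          exact mul_le_mul_of_nonneg_left h2 hc0
        · rw [Set.indicator_of_notMem hx]
          exact Finset.sum_nonneg fun a _ => Real.log_nonneg (one_le_al _ (det_sl _))

theorem final_contra (hκ : 2 ≤ κ) (hp : ∀ i, 0 < p i) (hp1 : ∑ i, p i = 1) (hμ : IsBernoulli p μ) (A : Sig κ → SL2) (hA : Continuous A) (η : ℝ) (hη : 0 < η) (hη2 : η ≤ 1/100)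
    (hb : ∀ (N : ℕ) (a : Win κ N → Fin 4) (k : ℕ), SS μ shift (fun x => (A x : Mat2)) (phi N a) η k 1 ≤ CC η) : False := by
  have := hμ.1
  set K := 4 * (|CC η| + 1) / η with hKdef
  have hK : 0 ≤ K := by positivity
  have hη4 : 0 < η^4 := by positivity
  have hη5 : η^4 ≤ 1 := pow_le_one₀ hη.le (by linarith)
  obtain ⟨k, hk⟩ : ∃ k : ℕ, (1 - η^4/10)^(2^k) * (2 * Real.exp K)^2 ≤ 1/4 := by
    have h1 := (tendsto_pow_atTop_nhds_zero_of_lt_one (r := 1 - η^4/10) (by linarith) (by linarith)).comp (tendsto_pow_atTop_atTop_of_one_lt (r := (2:ℕ)) (by norm_num))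
    have h2 := h1.mul_const ((2 * Real.exp K)^2)
    rw [zero_mul] at h2
    obtain ⟨k, hk⟩ := (h2.eventually (ge_mem_nhds (show (0:ℝ) < 1/4 by norm_num))).exists
    exact ⟨k, hk⟩
  obtain ⟨N, hN⟩ : ∃ N : ℕ, μ {x | ¬ (wl N (2^k) x).Nodup} ≤ 1/2 :=
    ((bad_tendsto hκ hp hp1 hμ (2^k)).eventually (ge_mem_nhds (show (0:ENNReal) < 1/2 by simp))).exists
  set c : ℝ := ((Fintype.card (Win κ N → Fin 4) : ℕ) : ℝ) with hc
  have hc0 : 0 < c := by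
    rw [hc]; exact_mod_cast Fintype.card_pos
  have hcv : ∀ a : Win κ N → Fin 4, ContinuousOn (fun t : ℝ => vv μ shift (fun x => (A x : Mat2)) (phi N a) (2^k) ((t:ℂ), ((1:ℝ):ℂ) * qf η t)) (Set.Icc (-η) η) := fun a =>
    path_cont (vv_contOn μ shift_cont (sl2_cont hA) (phi_cont N a) (fun x => det_sl (A x)) (norm_phi N a) (2^k)) η hη hη2 1 (by norm_num)
  have hle : -η ≤ η := by linarith
  have hii : ∀ a : Win κ N → Fin 4, IntervalIntegrable (fun t : ℝ => vv μ shift (fun x => (A x : Mat2)) (phi N a) (2^k) ((t:ℂ), ((1:ℝ):ℂ) * qf η t)) volume (-η) η := fun a =>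
    (hcv a).intervalIntegrable_of_Icc hle
  have e1 : ∑ a : Win κ N → Fin 4, SS μ shift (fun x => (A x : Mat2)) (phi N a) η k 1 ≤ c * CC η := by
    refine (Finset.sum_le_sum fun a _ => hb N a k).trans (le_of_eq ?_)
    rw [Finset.sum_const, Finset.card_univ, nsmul_eq_mul]
  have e2 : ∑ a : Win κ N → Fin 4, SS μ shift (fun x => (A x : Mat2)) (phi N a) η k 1 =
      ∫ t in (-η)..η, ∑ a : Win κ N → Fin 4, vv μ shift (fun x => (A x : Mat2)) (phi N a) (2^k) ((t:ℂ), ((1:ℝ):ℂ) * qf η t) := by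
    rw [intervalIntegral.integral_finset_sum fun a _ => hii a]; rfl
  have hint2 : IntervalIntegrable (fun t : ℝ => ∑ a : Win κ N → Fin 4, vv μ shift (fun x => (A x : Mat2)) (phi N a) (2^k) ((t:ℂ), ((1:ℝ):ℂ) * qf η t)) volume (-η) η :=
    (continuousOn_finset_sum _ fun a _ => hcv a).intervalIntegrable_of_Icc hle
  have e3 : ∫ t in (-(η/2))..(η/2), ∑ a : Win κ N → Fin 4, vv μ shift (fun x => (A x : Mat2)) (phi N a) (2^k) ((t:ℂ), ((1:ℝ):ℂ) * qf η t)
      ≤ ∫ t in (-η)..η, ∑ a : Win κ N → Fin 4, vv μ shift (fun x => (A x : Mat2)) (phi N a) (2^k) ((t:ℂ), ((1:ℝ):ℂ) * qf η t) := by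
    refine intervalIntegral.integral_mono_interval (by linarith) (by linarith) (by linarith) (Filter.Eventually.of_forall fun t => ?_) hint2
    refine Finset.sum_nonneg fun a _ => ?_
    rw [real_path_eq]
    exact vv_nonneg A (phi N a) (norm_phi N a) _ _ _
  have e4 : ∫ t in (-(η/2))..(η/2), (c * (K/4)) ≤ ∫ t in (-(η/2))..(η/2), ∑ a : Win κ N → Fin 4, vv μ shift (fun x => (A x : Mat2)) (phi N a) (2^k) ((t:ℂ), ((1:ℝ):ℂ) * qf η t) := by
    refine intervalIntegral.integral_mono_on (by linarith) intervalIntegrable_const (hint2.mono_set ?_) fun t ht => ?_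
    · rw [Set.uIcc_of_le hle, Set.uIcc_of_le (by linarith)]
      exact Set.Icc_subset_Icc (by linarith) (by linarith)
    · exact sum_vv_ge hμ A hA η hη hη2 K hK (2^k) N hk hN t (abs_le.2 ht)
  rw [intervalIntegral.integral_const, smul_eq_mul] at e4
  have e5 : (η/2 - -(η/2)) * (c * (K/4)) = c * (|CC η| + 1) := by
    rw [hKdef]; field_simp; ring
  have h6 : c * (|CC η| + 1) ≤ c * CC η := by
    rw [← e5]; linarith
  have h7 := le_of_mul_le_mul_left h6 hc0
  linarith [le_abs_self (CC η)]
end fin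

/-- **Avila's density theorem.** For every `γ ≥ 0`, the cocycles with positive Lyapunov
exponent are dense in `C^γ(Σ, SL₂(ℝ))`. -/
theorem avila_density {κ : ℕ} (hκ : 2 ≤ κ) (p : Fin κ → ℝ)
    (hp : ∀ i, 0 < p i) (hp1 : ∑ i, p i = 1)
    (μ : Measure (Sig κ)) (hμ : IsBernoulli p μ)
    (ζ : ℝ) (hζ : 1 < ζ) (γ : ℝ) (hγ : 0 ≤ γ)
    (A : Sig κ → SL2) (hA : Continuous A) (hAH : HolderCocycle ζ γ A) :
    ∀ ε : ℝ, 0 < ε → ∃ B : Sig κ → SL2, Continuous B ∧ HolderCocycle ζ γ B ∧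
      0 < lyap μ B ∧ CgammaClose ζ γ A B ε := by
  intro ε hε
  by_contra hneg
  obtain ⟨η, hη, hη2, hb⟩ := bound_of_neg hμ hζ hγ A hA hAH ε hε hneg
  exact final_contra hκ hp hp1 hμ A hA η hη hη2 hb
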